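/- arXiv:1202.2230 — 2 statements merged into one kernel-verified Lean document; each statement's English description precedes it below -/
import Mathlib

section
/- Gorenstein property of the parastatistics algebra: with K a field of characteristic 0, N a positive integer, V = K^N, A = T(V)/⟨[[x,y],z] : x,y,z ∈ V⟩, K the A-module via the augmentation, and d = N(N+1)/2, the Ext groups Ext^i_A(K, A) (A regarded as a left module over itself) vanish for all i ≠ d, and Ext^d_A(K, A) is a one-dimensional K-vector space. -/
open TensorAlgebra in
/-- The relation on the tensor algebra `T(V)` identifying every iterated ring commutator
`[[x,y],z]` of generators `x, y, z ∈ V` with `0`; quotienting by the two-sided ideal it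
generates yields the parastatistics algebra `T(V)/I`. -/
def psRel (K : Type) [Field K] (V : Type) [AddCommGroup V] [Module K V] :
    TensorAlgebra K V → TensorAlgebra K V → Prop := fun a b =>
  ∃ x y z : V, a = ⁅⁅ι K x, ι K y⁆, ι K z⁆ ∧ b = 0

/-- The parastatistics algebra `A = T(V)/⟨[[x,y],z] : x,y,z ∈ V⟩`. -/
abbrev PS (K : Type) [Field K] (V : Type) [AddCommGroup V] [Module K V] : Type :=
  RingQuot (psRel K V)

/-- The augmentation `ε : A → K` sending every generator `x ∈ V` to `0`. -/
noncomputable def psAug (K : Type) [Field K] (V : Type) [AddCommGroup V] [Module K V] :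
    PS K V →ₐ[K] K :=
  RingQuot.liftAlgHom K (s := psRel K V)
    ⟨TensorAlgebra.lift K (0 : V →ₗ[K] K), by
      rintro a b ⟨x, y, z, rfl, rfl⟩
      simp [Ring.lie_def]⟩

/-- `K` as a module over the parastatistics algebra, via the augmentation. -/
noncomputable instance psModuleK (K : Type) [Field K] (V : Type) [AddCommGroup V]
    [Module K V] : Module (PS K V) K :=
  Module.compHom K (psAug K V).toRingHom


section PSHomological
open CategoryTheory Abelian

lemma ps_extMk_zero_iff {C : Type*} [Category C] [Abelian C] [HasExt C] {X Y : C}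
    (P : ProjectiveResolution X) (f : P.complex.X 0 ⟶ Y) (m : ℕ) (hm : 0 + 1 = m)
    (hf : P.complex.d m 0 ≫ f = 0) : P.extMk f m hm hf = 0 ↔ f = 0 := by
  constructor
  · intro h
    rw [← P.extEquivCohomologyClass.apply_eq_iff_eq] at h
    simp only [ProjectiveResolution.extEquivCohomologyClass_extMk, ProjectiveResolution.extEquivCohomologyClass_zero,
      CochainComplex.HomComplex.CohomologyClass.mk_eq_zero_iff] at h
    rw [CochainComplex.HomComplex.Cocycle.toSingleMk_mem_coboundaries_iff _ _ _ _ _ 1 (by simp)] at h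
    obtain ⟨g, hg⟩ := h
    have h0 : Limits.IsZero (P.cochainComplex.X 1) :=
      P.cochainComplex.isZero_of_isStrictlyLE 0 1 (by lia)
    rw [h0.eq_of_src g 0, Limits.comp_zero] at hg
    rw [← cancel_epi (P.cochainComplexXIso (-(0:ℕ)) 0 rfl).hom, ← hg, Limits.comp_zero]
  · rintro rfl
    simp

lemma ps_extMk_smul {K : Type*} [Ring K] {C : Type*} [Category C] [Abelian C] [Linear K C] [HasExt C] {X Y : C}
    (P : ProjectiveResolution X) {n : ℕ} (f : P.complex.X n ⟶ Y) (m : ℕ) (hm : n + 1 = m)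
    (hf : P.complex.d m n ≫ f = 0) (r : K) :
    P.extMk (r • f) m hm (by simp [hf]) = r • P.extMk f m hm hf := by
  rw [Ext.smul_eq_comp_mk₀, P.extMk_comp_mk₀]
  simp

lemma ps_homology_equiv {K : Type} [Ring K] (S : ShortComplex (ModuleCat.{0} K)) {W : Type}
    [AddCommGroup W] [Module K W] (ψ : LinearMap.ker S.g.hom →ₗ[K] W) (hψ : Function.Surjective ψ)
    (hk : ∀ x, ψ x = 0 ↔ ∃ y, S.f y = x) : Nonempty (S.homology ≃ₗ[K] W) := by
  have e1 := S.moduleCatHomologyIso.toLinearEquiv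
  have hker : LinearMap.range S.moduleCatToCycles = LinearMap.ker ψ := by
    ext x
    simp only [LinearMap.mem_range, LinearMap.mem_ker, hk]
    constructor
    · rintro ⟨y, rfl⟩; exact ⟨y, rfl⟩
    · rintro ⟨y, hy⟩; exact ⟨y, Subtype.ext hy⟩
  have e2 := Submodule.quotEquivOfEq _ _ hker
  have e3 := ψ.quotKerEquivOfSurjective hψ
  exact ⟨e1.trans (e2.trans e3)⟩

lemma ps_ext_compare {K : Type} [Field K] {A : Type} [Ring A] [Algebra K A] (X Y : ModuleCat.{0} A) (n : ℕ) :
    Nonempty (((_root_.Ext K (ModuleCat.{0} A) n).obj (Opposite.op X)).obj Y ≃ₗ[K] Abelian.Ext.{0} X Y n) := by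
  let P := projectiveResolution X
  have e := (P.isoExt (R := K) n Y).toLinearEquiv
  let S := (P.complex.linearYonedaObj K Y).sc n
  have hn : (ComplexShape.up ℕ).next n = n + 1 := by simp
  have hker : ∀ x : P.complex.X n ⟶ Y, (show S.X₂ from x) ∈ LinearMap.ker S.g.hom ↔ P.complex.d (n+1) n ≫ x = 0 := by
    intro x
    rw [LinearMap.mem_ker]
    show P.complex.d ((ComplexShape.up ℕ).next n) n ≫ x = 0 ↔ _
    rw [hn]
  let ψ : LinearMap.ker S.g.hom →ₗ[K] Abelian.Ext.{0} X Y n :=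
    { toFun x := P.extMk (show P.complex.X n ⟶ Y from x.1) (n+1) rfl ((hker _).1 x.2)
      map_add' x y := by
        exact (P.add_extMk (show P.complex.X n ⟶ Y from x.1) (show P.complex.X n ⟶ Y from y.1)
          (n+1) rfl ((hker _).1 x.2) ((hker _).1 y.2)).symm
      map_smul' r x := by
        exact ps_extMk_smul P (show P.complex.X n ⟶ Y from x.1) (n+1) rfl ((hker _).1 x.2) r }
  obtain ⟨e2⟩ := ps_homology_equiv S ψ (by
    intro a
    obtain ⟨f, hf, rfl⟩ := P.extMk_surjective a (n+1) rfl
    exact ⟨⟨f, (hker f).2 hf⟩, rfl⟩) (by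
    intro x
    have hf : ∀ y : P.complex.X ((ComplexShape.up ℕ).prev n) ⟶ Y,
      S.f (show S.X₁ from y) = P.complex.d n ((ComplexShape.up ℕ).prev n) ≫ y := fun y => rfl
    show P.extMk (show P.complex.X n ⟶ Y from x.1) (n+1) rfl ((hker _).1 x.2) = 0 ↔ 
      ∃ y : P.complex.X ((ComplexShape.up ℕ).prev n) ⟶ Y,
        P.complex.d n ((ComplexShape.up ℕ).prev n) ≫ y = (show P.complex.X n ⟶ Y from x.1)
    cases n with
    | zero =>
      rw [ps_extMk_zero_iff]
      have : P.complex.d 0 ((ComplexShape.up ℕ).prev 0) = 0 := 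
        P.complex.shape _ _ (by simp)
      simp only [this, Limits.zero_comp]
      exact ⟨fun h => ⟨0, h.symm⟩, fun ⟨_, h⟩ => h.symm⟩
    | succ p =>
      have hp : (ComplexShape.up ℕ).prev (p+1) = p := by simp
      rw [P.extMk_eq_zero_iff _ _ _ _ p rfl, hp])
  exact ⟨e.trans e2⟩
open CategoryTheory Abelian

section Rees
variable {K : Type} [Field K] {A C : Type} [Ring A] [Ring C] [Algebra K A] [Algebra K C]

/-- restriction of scalars -/
noncomputable abbrev psR (f : A →ₐ[K] C) : ModuleCat.{0} C ⥤ ModuleCat.{0} A :=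
  ModuleCat.restrictScalars.{0} f.toRingHom

lemma ps_res_exact (f : A →ₐ[K] C) (S : ShortComplex (ModuleCat.{0} C)) (h : S.Exact) :
    (S.map (psR f)).Exact := by
  rw [CategoryTheory.ShortComplex.ShortExact.moduleCat_exact_iff_function_exact] at h ⊢
  exact h

instance ps_resPFL (f : A →ₐ[K] C) : Limits.PreservesFiniteLimits (psR f) := by
  have := ((CategoryTheory.Functor.exact_tfae (psR f)).out 1 3).mp (ps_res_exact f)
  exact this.1
instance ps_resPFC (f : A →ₐ[K] C) : Limits.PreservesFiniteColimits (psR f) := by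
  have := ((CategoryTheory.Functor.exact_tfae (psR f)).out 1 3).mp (ps_res_exact f)
  exact this.2

instance ps_resLinear (f : A →ₐ[K] C) : 
    (psR f).Linear K where
  map_smul {M N} g r := by
    ext m
    exact congr_arg (· • g.hom m) (f.commutes r).symm

/-- multiplication by a central element -/
def psMulZ (z : A) (hz : ∀ a, a * z = z * a) : ModuleCat.of A A ⟶ ModuleCat.of A A :=
  ModuleCat.ofHom
    { toFun a := z * a
      map_add' := mul_add z
      map_smul' a b := by simp only [smul_eq_mul, RingHom.id_apply, ← mul_assoc, hz] }

/-- the quotient map -/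
noncomputable def psQuot (f : A →ₐ[K] C) : ModuleCat.of A A ⟶
    (psR f).obj (ModuleCat.of C C) :=
  ModuleCat.ofHom (Y := (psR f).obj (ModuleCat.of C C))
    { toFun a := f a
      map_add' := map_add f
      map_smul' a b := map_mul f a b }

lemma ps_ses (f : A →ₐ[K] C) (hf : Function.Surjective f) (z : A) (hz : ∀ a, a * z = z * a)
    (hreg : ∀ a, z * a = 0 → a = 0) (hker : ∀ a, f a = 0 ↔ ∃ b, a = z * b) :
    ∃ h, (ShortComplex.mk (psMulZ z hz) (psQuot f) h).ShortExact := by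
  have h0 : psMulZ z hz ≫ psQuot f = 0 := by
    ext
    exact (hker _).2 ⟨_, rfl⟩
  refine ⟨h0, ?_⟩
  refine ModuleCat.shortComplex_shortExact _ ?_ ?_ hf
  · intro a
    refine (hker a).trans ⟨fun ⟨b, hb⟩ => ⟨b, hb.symm⟩, fun ⟨b, hb⟩ => ⟨b, hb.symm⟩⟩
  · refine (injective_iff_map_eq_zero (psMulZ z hz).hom).2 hreg

lemma ps_pd (f : A →ₐ[K] C) (hf : Function.Surjective f) (z : A) (hz : ∀ a, a * z = z * a)
    (hreg : ∀ a, z * a = 0 → a = 0) (hker : ∀ a, f a = 0 ↔ ∃ b, a = z * b) (I : Type) :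
    HasProjectiveDimensionLT
      ((psR f).obj (ModuleCat.of C (I →₀ C))) 2 := by
  let u : ModuleCat.of A (I →₀ A) ⟶ ModuleCat.of A (I →₀ A) := ModuleCat.ofHom
    (Finsupp.mapRange.linearMap (psMulZ z hz).hom)
  let v : ModuleCat.of A (I →₀ A) ⟶
    (psR f).obj (ModuleCat.of C (I →₀ C)) :=
    ModuleCat.ofHom (Y := (psR f).obj (ModuleCat.of C (I →₀ C)))
    { toFun x := Finsupp.mapRange f (map_zero f) x
      map_add' x y := Finsupp.mapRange_add (map_add f) x y
      map_smul' a x := by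
        show Finsupp.mapRange f (map_zero f) (a • x) = f a • Finsupp.mapRange f (map_zero f) x
        ext i
        simp }
  have hu : ∀ x i, (u x : I →₀ A) i = z * x i := fun x i => rfl
  have h0 : u ≫ v = 0 := by
    ext1
    apply LinearMap.ext
    intro x
    refine Finsupp.ext fun i => ?_
    exact (hker _).2 ⟨_, rfl⟩
  have hs : (ShortComplex.mk u v h0).ShortExact := by
    refine ModuleCat.shortComplex_shortExact _ ?_ ?_ ?_
    · intro x
      constructor
      · intro hx
        have : ∀ i, ∃ b, x i = z * b := fun i => (hker _).1 (DFunLike.congr_fun (show (show I →₀ C from v.hom x) = 0 from hx) i)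
        choose b hb using this
        refine ⟨Finsupp.onFinset x.support b ?_, ?_⟩
        · intro i hi
          rw [Finsupp.mem_support_iff, hb i]
          exact fun h => hi (hreg _ h)
        · exact Finsupp.ext fun i => (hb i).symm
      · rintro ⟨y, rfl⟩
        refine Finsupp.ext fun i => ?_
        exact (hker _).2 ⟨_, rfl⟩
    · refine (injective_iff_map_eq_zero u.hom).2 fun x hx => Finsupp.ext fun i => ?_
      exact hreg _ (DFunLike.congr_fun hx i)
    · exact Finsupp.mapRange_surjective f (map_zero f) hf
  have hp : Projective (ModuleCat.of A (I →₀ A)) :=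
    ModuleCat.projective_of_free (Finsupp.basisSingleOne (R := A) (ι := I))
  exact hs.hasProjectiveDimensionLT_X₃ 1 (inferInstanceAs (HasProjectiveDimensionLT (ModuleCat.of A (I →₀ A)) 1))
    (inferInstanceAs (HasProjectiveDimensionLT (ModuleCat.of A (I →₀ A)) (1+1)))

section central
open ModuleCat.Algebra
lemma ps_central_zero (z : A) (hz : ∀ a, a * z = z * a) (M : ModuleCat.{0} A) (hM : ∀ m : M, z • m = 0)
    (n : ℕ) (e : Abelian.Ext.{0} M (ModuleCat.of A A) n) :
    e.comp (Ext.mk₀ (psMulZ z hz)) (add_zero n) = 0 := by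
  let zc : Subring.center A := ⟨z, Subring.mem_center_iff.2 hz⟩
  have h1 : psMulZ z hz = zc • 𝟙 (ModuleCat.of A A) := by
    ext
    rfl
  have h2 : zc • 𝟙 M = 0 := by
    ext m
    exact hM m
  rw [h1, ← Ext.smul_eq_comp_mk₀]
  have : (Ext.mk₀ (𝟙 M)).comp e (zero_add n) = e := by simp
  rw [← this, ← Ext.smul_comp, ← Ext.mk₀_smul, h2]
  simp
end central

theorem ps_rees (f : A →ₐ[K] C) (hf : Function.Surjective f) (z : A) (hz : ∀ a, a * z = z * a)
    (hreg : ∀ a, z * a = 0 → a = 0) (hker : ∀ a, f a = 0 ↔ ∃ b, a = z * b) (M : ModuleCat.{0} C) :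
    Subsingleton (Abelian.Ext.{0} ((psR f).obj M) (ModuleCat.of A A) 0)
    ∧ ∀ n, Nonempty (Abelian.Ext.{0} M (ModuleCat.of C C) n ≃ₗ[K]
      Abelian.Ext.{0} ((psR f).obj M) (ModuleCat.of A A) (n + 1)) := by
  obtain ⟨h0, hS⟩ := ps_ses f hf z hz hreg hker
  have hzM : ∀ (M : ModuleCat.{0} C) (m : (psR f).obj M), z • m = 0 := by
    intro M m
    have : f z = 0 := (hker z).2 ⟨1, by simp⟩
    show (f z • (show M from m) : M) = 0
    rw [this, zero_smul]
  have hsub : ∀ M : ModuleCat.{0} C, Subsingleton (Abelian.Ext.{0} ((psR f).obj M) (ModuleCat.of A A) 0) := by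
    intro M
    suffices Subsingleton ((psR f).obj M ⟶ ModuleCat.of A A) from Ext.homEquiv₀.subsingleton
    refine subsingleton_of_forall_eq 0 fun g => ?_
    ext m
    apply hreg
    have : g (z • m) = z • g m := map_smul g.hom z m
    rw [hzM, map_zero] at this
    exact this.symm
  refine ⟨hsub M, ?_⟩
  let Φ : ∀ (M : ModuleCat.{0} C) (n : ℕ), Abelian.Ext.{0} M (ModuleCat.of C C) n →ₗ[K]
      Abelian.Ext.{0} ((psR f).obj M) (ModuleCat.of A A) (n + 1) := fun M n =>
    (Ext.postcompOfLinear hS.extClass K ((psR f).obj M) rfl).comp ((psR f).mapExtLinearMap K M (ModuleCat.of C C) n)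
  have hΦ : ∀ M n e, Φ M n e = (e.mapExactFunctor (psR f)).comp hS.extClass rfl := fun _ _ _ => rfl
  suffices ∀ n M, Function.Bijective (Φ M n) from fun n => ⟨LinearEquiv.ofBijective (Φ M n) (this n M)⟩
  clear M
  intro n
  induction n with
  | zero =>
    intro M
    constructor
    · refine (injective_iff_map_eq_zero _).2 fun e he => ?_
      rw [hΦ] at he
      obtain ⟨x, hx⟩ := Ext.covariant_sequence_exact₃ _ hS _ _ he
      rw [(hsub M).elim x 0, Ext.zero_comp] at hx
      obtain ⟨g, rfl⟩ := (Ext.mk₀_bijective _ _).2 e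
      rw [Ext.mapExactFunctor_mk₀] at hx
      have : (psR f).map g = 0 := (Ext.mk₀_bijective _ _).1 (by rw [← hx, Ext.mk₀_zero])
      have : g = 0 := (psR f).map_injective (by rw [this, Functor.map_zero])
      rw [this, Ext.mk₀_zero]
    · intro y
      obtain ⟨x, hx⟩ := Ext.covariant_sequence_exact₁ _ hS y
        (ps_central_zero z hz _ (hzM M) _ y) (zero_add 1)
      obtain ⟨g, rfl⟩ := (Ext.mk₀_bijective _ _).2 x
      let g' : M ⟶ ModuleCat.of C C := ModuleCat.ofHom
        { toFun m := g.hom (show (psR f).obj M from m)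
          map_add' x y := map_add g.hom (show (psR f).obj M from x) (show (psR f).obj M from y)
          map_smul' c x := by
            obtain ⟨a, rfl⟩ := hf c
            exact map_smul g.hom a (show (psR f).obj M from x) }
      refine ⟨Ext.mk₀ g', ?_⟩
      rw [hΦ, Ext.mapExactFunctor_mk₀]
      exact hx
  | succ n ih =>
    intro M
    let p : ModuleCat.of C (M →₀ C) ⟶ M := ModuleCat.ofHom (Finsupp.linearCombination C id)
    let T : ShortComplex (ModuleCat.{0} C) :=
      ShortComplex.mk (ModuleCat.ofHom (LinearMap.ker p.hom).subtype) p (by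
        ext x; exact x.2)
    have hT : T.ShortExact := by
      refine ModuleCat.shortComplex_shortExact _ ?_ ?_ ?_
      · intro x
        exact ⟨fun h => ⟨⟨x, h⟩, rfl⟩, fun ⟨y, hy⟩ => hy ▸ y.2⟩
      · exact Subtype.val_injective
      · exact Finsupp.linearCombination_id_surjective C M
    have hp : Projective T.X₂ :=
      ModuleCat.projective_of_free (Finsupp.basisSingleOne (R := C) (ι := M))
    have hpd : HasProjectiveDimensionLT (T.map (psR f)).X₂ 2 := ps_pd f hf z hz hreg hker M
    have hcomm : ∀ e : Abelian.Ext.{0} T.X₁ (ModuleCat.of C C) n,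
        Φ M (n+1) (hT.extClass.comp e (add_comm 1 n)) = (hT.map_of_exact (psR f)).extClass.comp (Φ T.X₁ n e) (by lia) := by
      intro e
      rw [hΦ, hΦ, Ext.mapExactFunctor_comp, Ext.mapExactFunctor_extClass]
      exact Ext.comp_assoc _ _ _ _ _ (by lia)
    have hnat : ∀ e : Abelian.Ext.{0} T.X₂ (ModuleCat.of C C) n,
        Φ T.X₁ n ((Ext.mk₀ T.f).comp e (zero_add n)) = (Ext.mk₀ ((psR f).map T.f)).comp (Φ T.X₂ n e) (zero_add _) := by
      intro e
      rw [hΦ, hΦ, Ext.mapExactFunctor_comp, Ext.mapExactFunctor_mk₀]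
      exact Ext.comp_assoc _ _ _ _ _ (by lia)
    constructor
    · refine (injective_iff_map_eq_zero _).2 fun e he => ?_
      obtain ⟨e', rfl⟩ := Ext.contravariant_sequence_exact₃ hT _ e
        (Ext.eq_zero_of_hasProjectiveDimensionLT _ 1 (by lia)) (add_comm 1 n)
      erw [hcomm] at he
      obtain ⟨w, hw⟩ := Ext.contravariant_sequence_exact₁ (hT.map_of_exact (psR f)) _ _ _ he
      obtain ⟨w', rfl⟩ := (ih T.X₂).2 w
      have : e' = (Ext.mk₀ T.f).comp w' (zero_add n) := by
        apply (ih T.X₁).1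
        rw [hnat]
        exact hw.symm
      rw [this, ShortComplex.ShortExact.extClass_comp_assoc]
    · intro y
      obtain ⟨y', hy'⟩ := Ext.contravariant_sequence_exact₃ (hT.map_of_exact (psR f)) _ y
        (Ext.eq_zero_of_hasProjectiveDimensionLT _ 2 (by lia)) (show 1 + (n + 1) = n + 1 + 1 by lia)
      obtain ⟨e', rfl⟩ := (ih T.X₁).2 y'
      exact ⟨hT.extClass.comp e' (add_comm 1 n), (hcomm e').trans hy'⟩
end Rees
open CategoryTheory Abelian

/-- The Gorenstein condition for an augmented algebra. -/
def PSP {K : Type} [Field K] (A : Type) [Ring A] [Algebra K A] (ε : A →ₐ[K] K) (d : ℕ) : Prop :=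
  (∀ i, i ≠ d → Subsingleton (Abelian.Ext.{0} ((psR ε).obj (ModuleCat.of K K)) (ModuleCat.of A A) i)) ∧
  Module.finrank K (Abelian.Ext.{0} ((psR ε).obj (ModuleCat.of K K)) (ModuleCat.of A A) d) = 1

/-- The isomorphism invariant Gorenstein condition for an augmented algebra. -/
def PSGor {K : Type} [Field K] (A : Type) [Ring A] [Algebra K A] (ε : A →ₐ[K] K) (d : ℕ) : Prop :=
  ∀ (B : Type) [Ring B] [Algebra K B] (e : B ≃ₐ[K] A), PSP B (ε.comp e.toAlgHom) d

section
variable {K : Type} [Field K] {A C : Type} [Ring A] [Ring C] [Algebra K A] [Algebra K C]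

lemma PSGor.of_equiv {ε : C →ₐ[K] K} {d : ℕ} (h : PSGor C ε d) (e : A ≃ₐ[K] C)
    {ε' : A →ₐ[K] K} (hε : ∀ a, ε' a = ε (e a)) : PSGor A ε' d := by
  intro B _ _ e'
  have := h B (e'.trans e)
  convert this using 1
  ext b
  simp [hε]

lemma PSP.step (f : A →ₐ[K] C) (hf : Function.Surjective f) (z : A) (hz : ∀ a, a * z = z * a)
    (hreg : ∀ a, z * a = 0 → a = 0) (hker : ∀ a, f a = 0 ↔ ∃ b, a = z * b)
    {ε : C →ₐ[K] K} {d : ℕ} (h : PSP C ε d) : PSP A (ε.comp f) (d + 1) := by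
  obtain ⟨h0, h1⟩ := ps_rees f hf z hz hreg hker ((psR ε).obj (ModuleCat.of K K))
  have hM : (psR f).obj ((psR ε).obj (ModuleCat.of K K)) = (psR (ε.comp f)).obj (ModuleCat.of K K) := rfl
  rw [hM] at h0 h1
  refine ⟨?_, ?_⟩
  · rintro (_ | i) hi
    · exact h0
    · obtain ⟨e⟩ := h1 i
      have := h.1 i (by lia)
      exact e.symm.toEquiv.subsingleton
  · obtain ⟨e⟩ := h1 d
    rw [← e.finrank_eq]
    exact h.2

lemma PSGor.step (f : A →ₐ[K] C) (hf : Function.Surjective f) (z : A) (hz : ∀ a, a * z = z * a)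
    (hreg : ∀ a, z * a = 0 → a = 0) (hker : ∀ a, f a = 0 ↔ ∃ b, a = z * b)
    {ε : C →ₐ[K] K} {d : ℕ} (h : PSGor C ε d) {ε' : A →ₐ[K] K} (hε : ∀ a, ε' a = ε (f a)) :
    PSGor A ε' (d + 1) := by
  intro B _ _ e
  have h1 := h C (AlgEquiv.refl)
  have h2 := PSP.step (f.comp e.toAlgHom) (hf.comp e.surjective) (e.symm z)
    (fun b => e.injective (by simp [hz]))
    (fun b hb => by
      apply e.injective
      rw [map_zero]
      apply hreg
      simpa using congrArg e hb)
    (fun b => by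
      show f (e b) = 0 ↔ _
      rw [hker]
      constructor
      · rintro ⟨b', hb'⟩
        exact ⟨e.symm b', e.injective (by simp [hb'])⟩
      · rintro ⟨b', rfl⟩
        exact ⟨e b', by simp⟩) h1
  convert h2 using 1
  ext b
  simp [hε]

lemma PSP.base (ε : A →ₐ[K] K) (h : Function.Bijective ε) : PSP A ε 0 := by
  let E : A ≃ₐ[K] K := AlgEquiv.ofBijective ε h
  have hE : ∀ a, E a = ε a := fun a => rfl
  let g1 : (psR ε).obj (ModuleCat.of K K) ⟶ ModuleCat.of A A := 
    ModuleCat.ofHom (X := (psR ε).obj (ModuleCat.of K K))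
    { toFun k := E.symm k
      map_add' := map_add E.symm
      map_smul' a k := by
        refine (map_mul E.symm (E a) k).trans ?_
        rw [E.symm_apply_apply]; rfl }
  let g2 : ModuleCat.of A A ⟶ (psR ε).obj (ModuleCat.of K K) := psQuot ε
  let g : (psR ε).obj (ModuleCat.of K K) ≅ ModuleCat.of A A := 
    ⟨g1, g2, by ext k; exact E.apply_symm_apply k, by ext; exact E.symm_apply_apply (1 : A)⟩
  have hp : Projective (ModuleCat.of A A) :=
    ModuleCat.projective_of_free (Module.Basis.singleton Unit A)
  have hp' : Projective ((psR ε).obj (ModuleCat.of K K)) := Projective.of_iso g.symm hp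
  constructor
  · intro i hi
    exact HasProjectiveDimensionLT.subsingleton _ 1 i (by lia) _
  · have key : ∀ a : A, a = algebraMap K A (ε a) := fun a => h.1 (by simp)
    refine finrank_eq_one_iff'.2 ⟨Ext.mk₀ g1, ?_, ?_⟩
    · intro h0
      rw [Ext.mk₀_eq_zero_iff] at h0
      have h1 : E.symm 1 = 0 := congrArg (fun u : (psR ε).obj (ModuleCat.of K K) ⟶ ModuleCat.of A A => u.hom (show (psR ε).obj (ModuleCat.of K K) from (1 : K))) h0
      have h2 := congrArg E h1
      simp at h2
    · intro w
      obtain ⟨w, rfl⟩ := (Ext.mk₀_bijective _ _).2 w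
      obtain ⟨c, hc⟩ : ∃ c, c = ε (w.hom (show (psR ε).obj (ModuleCat.of K K) from (1 : K))) := ⟨_, rfl⟩
      refine ⟨c, ?_⟩
      rw [← Ext.mk₀_smul]
      congr 1
      ext k
      have h2 : k = (E.symm k) • (show (psR ε).obj (ModuleCat.of K K) from (1 : K)) := by
        refine Eq.trans ?_ (mul_one (E (E.symm k))).symm
        exact (E.apply_symm_apply k).symm
      have h3 : w.hom k = E.symm k * w.hom (show (psR ε).obj (ModuleCat.of K K) from (1 : K)) := by
        conv_lhs => rw [h2]
        exact map_smul w.hom _ _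
      refine Eq.trans ?_ h3.symm
      rw [key (w.hom (show (psR ε).obj (ModuleCat.of K K) from (1 : K))), ← hc, ← Algebra.commutes]
      rfl

lemma PSGor.base (ε : A →ₐ[K] K) (h : Function.Bijective ε) : PSGor A ε 0 :=
  fun _ _ _ e => PSP.base _ (h.comp e.bijective)
end

lemma ps_kill {S : Type} [CommRing S] (n : ℕ) :
   ∀ p : MvPolynomial (Fin (n+1)) S, MvPolynomial.aeval (Fin.cons 0 MvPolynomial.X : Fin (n+1) → MvPolynomial (Fin n) S) p = 0
    ↔ ∃ q, p = MvPolynomial.X 0 * q := by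
  have e0 : (MvPolynomial.finSuccEquiv S n).symm Polynomial.X = MvPolynomial.X 0 :=
    (MvPolynomial.finSuccEquiv S n).injective (by simp [MvPolynomial.finSuccEquiv_X_zero])
  have e1 : ∀ j, (MvPolynomial.finSuccEquiv S n).symm (Polynomial.C (MvPolynomial.X j)) = MvPolynomial.X (Fin.succ j) :=
    fun j => (MvPolynomial.finSuccEquiv S n).injective (by simp [MvPolynomial.finSuccEquiv_X_succ])
  intro p
  constructor
  · intro hp
    obtain ⟨q, rfl⟩ := (MvPolynomial.finSuccEquiv S n).symm.surjective p
    have : (MvPolynomial.aeval (Fin.cons 0 MvPolynomial.X : Fin (n+1) → MvPolynomial (Fin n) S)).comp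
      (MvPolynomial.finSuccEquiv S n).symm.toAlgHom = ((Polynomial.aeval (0 : MvPolynomial (Fin n) S)).restrictScalars S) := by
      rw [← AlgHom.cancel_right (f := (MvPolynomial.finSuccEquiv S n).toAlgHom) (MvPolynomial.finSuccEquiv S n).surjective]
      ext i
      refine Fin.cases ?_ (fun j => ?_) i <;> simp [MvPolynomial.finSuccEquiv_X_zero, MvPolynomial.finSuccEquiv_X_succ, e0, e1]
    have h2 := (DFunLike.congr_fun this q).symm.trans hp
    obtain ⟨r, hr⟩ := Polynomial.X_dvd_iff.2 (show q.coeff 0 = 0 by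
      rw [Polynomial.coeff_zero_eq_aeval_zero]; simpa using h2)
    refine ⟨(MvPolynomial.finSuccEquiv S n).symm r, ?_⟩
    rw [hr, map_mul, e0]
  · rintro ⟨q, rfl⟩
    simp

lemma ps_kill_surj {S : Type} [CommRing S] (n : ℕ) : Function.Surjective 
   (MvPolynomial.aeval (R := S) (Fin.cons 0 MvPolynomial.X : Fin (n+1) → MvPolynomial (Fin n) S)) := by
  intro p
  refine ⟨MvPolynomial.rename Fin.succ p, ?_⟩
  rw [MvPolynomial.aeval_rename]
  exact MvPolynomial.aeval_X_left_apply p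

lemma PSGor.mvPoly {K : Type} [Field K] (n : ℕ) : 
   PSGor (MvPolynomial (Fin n) K) (MvPolynomial.aeval 0) n := by
  induction n with
  | zero => 
    apply PSGor.base
    constructor
    · refine (injective_iff_map_eq_zero _).2 fun u hu => ?_
      rw [MvPolynomial.eq_C_of_isEmpty u] at hu ⊢
      simp at hu
      simp [hu]
    · intro k
      exact ⟨MvPolynomial.C k, by simp⟩
  | succ n ih =>
    refine PSGor.step _ (ps_kill_surj n) (MvPolynomial.X 0) (fun a => mul_comm _ _) ?_ (ps_kill n) ih ?_
    · intro a ha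
      simpa using ha
    · intro a
      rw [← AlgHom.comp_apply]
      congr 1
      ext i
      refine Fin.cases ?_ (fun j => ?_) i <;> simp
end PSHomological

section PW
variable {R : Type} [CommRing R] {N : ℕ}

/-- relations for the Weyl type algebra -/
def pwRel (ω : Fin N → Fin N → R) : FreeAlgebra R (Fin N) → FreeAlgebra R (Fin N) → Prop :=
  fun a b => ∃ i j, a = FreeAlgebra.ι R i * FreeAlgebra.ι R j ∧
    b = FreeAlgebra.ι R j * FreeAlgebra.ι R i + algebraMap R _ (ω i j)

/-- The Weyl type algebra with commutation form `ω`. -/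
def PW (ω : Fin N → Fin N → R) : Type := RingQuot (pwRel ω)

namespace PW

noncomputable instance (ω : Fin N → Fin N → R) : Ring (PW ω) :=
  inferInstanceAs (Ring (RingQuot (pwRel ω)))
noncomputable instance (ω : Fin N → Fin N → R) : Algebra R (PW ω) :=
  inferInstanceAs (Algebra R (RingQuot (pwRel ω)))

/-- generators -/
noncomputable def x (ω : Fin N → Fin N → R) (i : Fin N) : PW ω :=
  RingQuot.mkAlgHom R (pwRel ω) (FreeAlgebra.ι R i)

lemma x_mul (ω : Fin N → Fin N → R) (i j : Fin N) :
    x ω i * x ω j = x ω j * x ω i + algebraMap R _ (ω i j) := by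
  have := RingQuot.mkAlgHom_rel R (s := pwRel ω) ⟨i, j, rfl, rfl⟩
  rw [map_mul, map_add, map_mul, AlgHom.commutes] at this
  exact this

/-- universal property -/
noncomputable def liftA (ω : Fin N → Fin N → R) {S : Type} [Ring S] [Algebra R S] (f : Fin N → S)
    (h : ∀ i j, f i * f j = f j * f i + algebraMap R S (ω i j)) : PW ω →ₐ[R] S :=
  RingQuot.liftAlgHom R (s := pwRel ω) ⟨FreeAlgebra.lift R f, by
    rintro a b ⟨i, j, rfl, rfl⟩
    simpa using h i j⟩

lemma liftA_x (ω : Fin N → Fin N → R) {S : Type} [Ring S] [Algebra R S] (f : Fin N → S)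
    (h : ∀ i j, f i * f j = f j * f i + algebraMap R S (ω i j)) (i : Fin N) :
    liftA ω f h (x ω i) = f i := by
  unfold liftA x
  erw [RingQuot.liftAlgHom_mkAlgHom_apply]
  simp

lemma gen_induction (ω : Fin N → Fin N → R) (P : PW ω → Prop)
    (halg : ∀ r, P (algebraMap R _ r)) (hx : ∀ i, P (x ω i))
    (hadd : ∀ a b, P a → P b → P (a + b)) (hmul : ∀ a b, P a → P b → P (a * b)) (a : PW ω) : P a := by
  obtain ⟨a, rfl⟩ := RingQuot.mkAlgHom_surjective R (pwRel ω) a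
  refine FreeAlgebra.induction R (Fin N) (motive := fun a => P (RingQuot.mkAlgHom R (pwRel ω) a)) ?_ ?_ ?_ ?_ a
  · intro r
    rw [AlgHom.commutes]
    exact halg r
  · exact hx
  · intro a b ha hb
    rw [map_mul]
    exact hmul _ _ ha hb
  · intro a b ha hb
    rw [map_add]
    exact hadd _ _ ha hb

lemma left_induction {ω : Fin N → Fin N → R} (P : PW ω → Prop)
    (h1 : P 1) (hsmul : ∀ (r : R) a, P a → P (r • a))
    (hadd : ∀ a b, P a → P b → P (a + b)) (hx : ∀ i a, P a → P (x ω i * a)) (a : PW ω) : P a := by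
  suffices ∀ b, P b → P (a * b) by simpa using this 1 h1
  refine gen_induction ω (fun a => ∀ b, P b → P (a * b)) ?_ ?_ ?_ ?_ a
  · intro r b hb
    rw [← Algebra.smul_def]
    exact hsmul r b hb
  · intro i b hb
    exact hx i b hb
  · intro a a' ha ha' b hb
    rw [add_mul]
    exact hadd _ _ (ha b hb) (ha' b hb)
  · intro a a' ha ha' b hb
    rw [mul_assoc]
    exact ha _ (ha' b hb)

/-- universal property, central coefficients version -/
noncomputable def lift (ω : Fin N → Fin N → R) {S : Type} [Ring S] (σ : R →+* S)
    (hσ : ∀ r s, σ r * s = s * σ r) (f : Fin N → S)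
    (h : ∀ i j, f i * f j = f j * f i + σ (ω i j)) : PW ω →+* S :=
  letI : Algebra R S := σ.toAlgebra' hσ
  (liftA ω f h).toRingHom

section
variable (ω : Fin N → Fin N → R) {S : Type} [Ring S] (σ : R →+* S)
    (hσ : ∀ r s, σ r * s = s * σ r) (f : Fin N → S)
    (h : ∀ i j, f i * f j = f j * f i + σ (ω i j))
lemma lift_x (i : Fin N) : lift ω σ hσ f h (x ω i) = f i :=
  letI : Algebra R S := σ.toAlgebra' hσ
  liftA_x ω f h i
lemma lift_alg (r : R) : lift ω σ hσ f h (algebraMap R _ r) = σ r :=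
  letI : Algebra R S := σ.toAlgebra' hσ
  (liftA ω f h).commutes r
end

lemma hom_ext {ω : Fin N → Fin N → R} {S : Type} [Ring S] {f g : PW ω →+* S}
    (h1 : ∀ r, f (algebraMap R _ r) = g (algebraMap R _ r)) (h2 : ∀ i, f (x ω i) = g (x ω i)) (a : PW ω) :
    f a = g a := by
  refine gen_induction ω (fun a => f a = g a) h1 h2 ?_ ?_ a
  · intro a b ha hb
    rw [map_add, map_add, ha, hb]
  · intro a b ha hb
    rw [map_mul, map_mul, ha, hb]

/-- the homomorphism to dual numbers -/
noncomputable def dual (ω : Fin N → Fin N → R) (v : Fin N → R) : PW ω →ₐ[R] TrivSqZeroExt (PW ω) (PW ω) :=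
  liftA ω (fun i => TrivSqZeroExt.inl (x ω i) + TrivSqZeroExt.inr (algebraMap R _ (v i))) (by
    intro i j
    ext
    · simp [x_mul ω i j, TrivSqZeroExt.algebraMap_eq_inl']
    · simp [TrivSqZeroExt.algebraMap_eq_inl']
      exact add_comm _ _)

/-- derivation -/
noncomputable def D (ω : Fin N → Fin N → R) (v : Fin N → R) : PW ω →ₗ[R] PW ω :=
  (TrivSqZeroExt.sndHom (PW ω) (PW ω)).restrictScalars R ∘ₗ (dual ω v).toLinearMap

lemma dual_fst (ω : Fin N → Fin N → R) (v : Fin N → R) (a : PW ω) : (dual ω v a).fst = a := by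
  refine hom_ext (f := ((TrivSqZeroExt.fstHom R (PW ω) (PW ω)).comp (dual ω v)).toRingHom)
    (g := RingHom.id _) ?_ ?_ a
  · intro r
    simp
  · intro i
    simp [dual, liftA_x]

variable {ω : Fin N → Fin N → R}

lemma D_one (v : Fin N → R) : D ω v 1 = 0 := by
  simp [D]

lemma D_x_mul (v : Fin N → R) (i : Fin N) (a : PW ω) :
    D ω v (x ω i * a) = v i • a + x ω i * D ω v a := by
  have : D ω v (x ω i * a) = (dual ω v (x ω i * a)).snd := rfl
  rw [this, map_mul]
  have h2 : D ω v a = (dual ω v a).snd := rfl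
  rw [TrivSqZeroExt.snd_mul, dual_fst, dual_fst, h2]
  simp [dual, liftA_x, Algebra.smul_def, add_comm, TrivSqZeroExt.algebraMap_eq_inl']

lemma D_comm (v w : Fin N → R) (a : PW ω) : D ω v (D ω w a) = D ω w (D ω v a) := by
  refine left_induction (fun a => D ω v (D ω w a) = D ω w (D ω v a)) ?_ ?_ ?_ ?_ a
  · simp [D_one]
  · intro r a ha
    simp [ha]
  · intro a b ha hb
    simp [ha, hb]
  · intro i a ha
    simp only [D_x_mul, map_add, map_smul, ha]
    abel

lemma D_neg (v : Fin N → R) (a : PW ω) : D ω (-v) a = - D ω v a := by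
  refine left_induction (fun a => D ω (-v) a = - D ω v a) ?_ ?_ ?_ ?_ a
  · simp [D_one]
  · intro r a ha
    simp [ha]
  · intro a b ha hb
    simp only [map_add, ha, hb]
    abel
  · intro i a ha
    simp only [D_x_mul, ha, Pi.neg_apply, neg_smul, mul_neg, neg_add]

/-- twisted action -/
noncomputable def act (ω ω' B : Fin N → Fin N → R) (h : ∀ i j, ω i j = ω' i j + B i j - B j i) :
    PW ω →ₐ[R] Module.End R (PW ω') :=
  liftA ω (fun i => LinearMap.mulLeft R (x ω' i) + D ω' (B i)) (by
    intro i j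
    ext a
    simp only [Module.End.mul_apply, LinearMap.add_apply, LinearMap.mulLeft_apply, map_add, D_x_mul,
      Module.algebraMap_end_apply, h, mul_add, ← mul_assoc, x_mul ω' i j, add_mul, D_comm (B i) (B j),
      Algebra.smul_def, map_sub, LinearMap.sub_apply]
    abel)

/-- comparison -/
noncomputable def phi (ω ω' B : Fin N → Fin N → R) (h : ∀ i j, ω i j = ω' i j + B i j - B j i) :
    PW ω →ₗ[R] PW ω' :=
  LinearMap.applyₗ (1 : PW ω') ∘ₗ (act ω ω' B h).toLinearMap

section
variable {ω' B : Fin N → Fin N → R} (h : ∀ i j, ω i j = ω' i j + B i j - B j i)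

lemma phi_one : phi ω ω' B h 1 = 1 := by
  simp [phi]
lemma phi_x_mul (i : Fin N) (a : PW ω) :
    phi ω ω' B h (x ω i * a) = x ω' i * phi ω ω' B h a + D ω' (B i) (phi ω ω' B h a) := by
  simp [phi, act, liftA_x]
lemma phi_D (v : Fin N → R) (a : PW ω) : phi ω ω' B h (D ω v a) = D ω' v (phi ω ω' B h a) := by
  refine left_induction (fun a => phi ω ω' B h (D ω v a) = D ω' v (phi ω ω' B h a)) ?_ ?_ ?_ ?_ a
  · simp [D_one, phi_one]
  · intro r a ha
    simp [ha]
  · intro a b ha hb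
    simp [ha, hb]
  · intro i a ha
    simp only [D_x_mul, map_add, map_smul, phi_x_mul, ha, D_comm v (B i)]
    abel

lemma phi_phi (h' : ∀ i j, ω' i j = ω i j + (-B) i j - (-B) j i) (a : PW ω) :
    phi ω' ω (-B) h' (phi ω ω' B h a) = a := by
  refine left_induction (fun a => phi ω' ω (-B) h' (phi ω ω' B h a) = a) ?_ ?_ ?_ ?_ a
  · simp [phi_one]
  · intro r a ha
    simp [ha]
  · intro a b ha hb
    simp [ha, hb]
  · intro i a ha
    simp only [phi_x_mul, map_add, ha, phi_D, Pi.neg_apply, D_neg]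
    abel

lemma phi_bij : Function.Bijective (phi ω ω' B h) := by
  have h' : ∀ i j, ω' i j = ω i j + (-B) i j - (-B) j i := by
    intro i j
    simp only [h, Pi.neg_apply]
    ring
  refine ⟨(Function.LeftInverse.injective (phi_phi h h')), fun a => ⟨phi ω' ω (-B) h' a, ?_⟩⟩
  have h'' : ∀ i j, ω i j = ω' i j + (- -B) i j - (- -B) j i := by simpa using h
  have := phi_phi h' h'' a
  simpa using this
end

end PW
end PW

namespace PW
section
variable {R R' : Type} [CommRing R] [CommRing R'] {N : ℕ}

/-- base change -/
noncomputable def bc (π : R →+* R') (ω : Fin N → Fin N → R) (ω' : Fin N → Fin N → R')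
    (h : ∀ i j, ω' i j = π (ω i j)) : PW ω →+* PW ω' :=
  lift ω ((algebraMap R' (PW ω')).comp π) (fun r s => Algebra.commutes (π r) s) (x ω')
    (fun i j => by rw [x_mul ω' i j, h]; rfl)

variable {π : R →+* R'} {ω : Fin N → Fin N → R} {ω' : Fin N → Fin N → R'}
    (h : ∀ i j, ω' i j = π (ω i j))

lemma bc_x (i : Fin N) : bc π ω ω' h (x ω i) = x ω' i := lift_x _ _ _ _ _ _
lemma bc_alg (r : R) : bc π ω ω' h (algebraMap R _ r) = algebraMap R' _ (π r) := lift_alg _ _ _ _ _ _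
lemma bc_smul (r : R) (a : PW ω) : bc π ω ω' h (r • a) = π r • bc π ω ω' h a := by
  rw [Algebra.smul_def, map_mul, bc_alg, ← Algebra.smul_def]

lemma bc_D (v : Fin N → R) (a : PW ω) :
    bc π ω ω' h (D ω v a) = D ω' (fun i => π (v i)) (bc π ω ω' h a) := by
  refine left_induction (fun a => bc π ω ω' h (D ω v a) = D ω' (fun i => π (v i)) (bc π ω ω' h a))
    ?_ ?_ ?_ ?_ a
  · simp [D_one]
  · intro r a ha
    simp [ha, bc_smul]
  · intro a b ha hb
    simp [ha, hb]
  · intro i a ha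
    simp only [D_x_mul, map_add, map_mul, bc_smul, bc_x, ha]

lemma bc_phi {τ B : Fin N → Fin N → R} {τ' B' : Fin N → Fin N → R'} (ht : ∀ i j, τ' i j = π (τ i j))
    (hB : ∀ i j, B' i j = π (B i j)) (h1 : ∀ i j, ω i j = τ i j + B i j - B j i)
    (h2 : ∀ i j, ω' i j = τ' i j + B' i j - B' j i) (a : PW ω) :
    bc π τ τ' ht (phi ω τ B h1 a) = phi ω' τ' B' h2 (bc π ω ω' h a) := by
  refine left_induction (fun a => bc π τ τ' ht (phi ω τ B h1 a) = phi ω' τ' B' h2 (bc π ω ω' h a))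
    ?_ ?_ ?_ ?_ a
  · simp [phi_one]
  · intro r a ha
    simp [ha, bc_smul]
  · intro a b ha hb
    simp [ha, hb]
  · intro i a ha
    have : B' i = fun j => π (B i j) := funext (hB i)
    simp only [phi_x_mul, map_add, map_mul, bc_x, ha, bc_D, this]
end

section
variable (R : Type) [CommRing R] (N : ℕ)

/-- comparison with polynomials -/
noncomputable def toPoly : PW (0 : Fin N → Fin N → R) →ₐ[R] MvPolynomial (Fin N) R :=
  liftA _ MvPolynomial.X (fun i j => by simp [mul_comm])

lemma comm0 (a b : PW (0 : Fin N → Fin N → R)) : a * b = b * a := by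
  refine gen_induction _ (fun a => a * b = b * a) (fun r => Algebra.commutes _ _) ?_ ?_ ?_ a
  · intro i
    refine gen_induction _ (fun b => x _ i * b = b * x _ i) (fun r => (Algebra.commutes _ _).symm) ?_ ?_ ?_ b
    · intro j
      rw [x_mul]
      simp
    · intro a b ha hb
      rw [mul_add, add_mul, ha, hb]
    · intro a b ha hb
      rw [← mul_assoc, ha, mul_assoc, hb, mul_assoc]
  · intro a c ha hc
    rw [mul_add, add_mul, ha, hc]
  · intro a c ha hc
    rw [mul_assoc, hc, ← mul_assoc, ha, mul_assoc]

lemma toPoly_bij : Function.Bijective (toPoly R N) := by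
  let _ : CommRing (PW (0 : Fin N → Fin N → R)) := { (inferInstance : Ring (PW (0 : Fin N → Fin N → R))) with mul_comm := comm0 R N }
  let ψ : MvPolynomial (Fin N) R →ₐ[R] PW (0 : Fin N → Fin N → R) := MvPolynomial.aeval (x _)
  constructor
  · refine Function.LeftInverse.injective (g := ψ) fun a => ?_
    refine hom_ext (f := ψ.toRingHom.comp (toPoly R N).toRingHom) (g := RingHom.id _) ?_ ?_ a
    · intro r
      simp
    · intro i
      simp [toPoly, liftA_x, ψ]
  · refine Function.RightInverse.surjective (g := ψ) fun a => ?_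
    have : (toPoly R N).comp ψ = AlgHom.id R _ := by
      ext i
      simp [toPoly, liftA_x, ψ]
    exact DFunLike.congr_fun this a

variable {R N} in
lemma toPoly_bc {R' : Type} [CommRing R'] {π : R →+* R'} 
    (h : ∀ i j, (0 : Fin N → Fin N → R') i j = π ((0 : Fin N → Fin N → R) i j)) (a) :
    toPoly R' N (bc π _ _ h a) = MvPolynomial.map π (toPoly R N a) := by
  refine hom_ext (f := (toPoly R' N).toRingHom.comp (bc π _ _ h)) (g := (MvPolynomial.map π).comp (toPoly R N).toRingHom)
    ?_ ?_ a
  · intro r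
    simp [bc_alg, MvPolynomial.algebraMap_eq]
  · intro i
    simp [bc_x, toPoly, liftA_x]
end

section
variable {R : Type} [CommRing R] {N : ℕ}

/-- triangular part -/
def tri (ω : Fin N → Fin N → R) : Fin N → Fin N → R := fun i j => if j < i then ω i j else 0

lemma tri_spec {ω : Fin N → Fin N → R} (h0 : ∀ i, ω i i = 0) (h1 : ∀ i j, ω i j = - ω j i) (i j : Fin N) :
    ω i j = (0 : Fin N → Fin N → R) i j + tri ω i j - tri ω j i := by
  unfold tri
  rcases lt_trichotomy i j with h | h | h
  · simp [h, h.not_gt, h1 i j]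
  · subst h
    simp [h0]
  · simp [h, h.not_gt]

/-- PBW isomorphism -/
noncomputable def pbw {ω : Fin N → Fin N → R} (h0 : ∀ i, ω i i = 0) (h1 : ∀ i j, ω i j = - ω j i) :
    PW ω →ₗ[R] MvPolynomial (Fin N) R :=
  (toPoly R N).toLinearMap ∘ₗ phi ω 0 (tri ω) (tri_spec h0 h1)

lemma pbw_bij {ω : Fin N → Fin N → R} (h0 : ∀ i, ω i i = 0) (h1 : ∀ i j, ω i j = - ω j i) :
    Function.Bijective (pbw h0 h1) :=
  (toPoly_bij R N).comp (phi_bij _)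

lemma pbw_bc {R' : Type} [CommRing R'] {π : R →+* R'} {ω : Fin N → Fin N → R} {ω' : Fin N → Fin N → R'}
    (h : ∀ i j, ω' i j = π (ω i j)) (h0 : ∀ i, ω i i = 0) (h1 : ∀ i j, ω i j = - ω j i)
    (h0' : ∀ i, ω' i i = 0) (h1' : ∀ i j, ω' i j = - ω' j i) (a : PW ω) :
    pbw h0' h1' (bc π ω ω' h a) = MvPolynomial.map π (pbw h0 h1 a) := by
  show toPoly R' N (phi ω' 0 (tri ω') _ _) = MvPolynomial.map π (toPoly R N (phi ω 0 (tri ω) _ _))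
  rw [← bc_phi (ω := ω) (τ := 0) (B := tri ω) (π := π) h (by simp) _ (tri_spec h0 h1), toPoly_bc]
  intro i j
  unfold tri
  split_ifs <;> simp [h]
end
end PW

namespace PW
section
variable {K : Type} [Field K] {N : ℕ}

noncomputable instance kalg {m : ℕ} (ω : Fin N → Fin N → MvPolynomial (Fin m) K) : Algebra K (PW ω) :=
  Algebra.compHom (PW ω) (algebraMap K (MvPolynomial (Fin m) K))

lemma kalg_map {m : ℕ} (ω : Fin N → Fin N → MvPolynomial (Fin m) K) (k : K) :
    algebraMap K (PW ω) k = algebraMap (MvPolynomial (Fin m) K) (PW ω) (MvPolynomial.C k) := rfl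

/-- augmentation -/
noncomputable def aug {m : ℕ} (ω : Fin N → Fin N → MvPolynomial (Fin m) K)
    (hc : ∀ i j, MvPolynomial.aeval (0 : Fin m → K) (ω i j) = 0) : PW ω →ₐ[K] K :=
  { lift ω (MvPolynomial.aeval (0 : Fin m → K)).toRingHom (fun r s => mul_comm _ _) 0
      (fun i j => by simpa using (hc i j).symm) with
    commutes' k := by
      refine (lift_alg ω _ _ _ _ (MvPolynomial.C k)).trans ?_
      simp }

lemma aug_x {m : ℕ} (ω : Fin N → Fin N → MvPolynomial (Fin m) K) (hc) (i) :
    aug ω hc (x ω i) = 0 := lift_x ω _ _ _ _ i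
lemma aug_alg {m : ℕ} (ω : Fin N → Fin N → MvPolynomial (Fin m) K) (hc) (r) :
    aug ω hc (algebraMap (MvPolynomial (Fin m) K) _ r) = MvPolynomial.aeval (0 : Fin m → K) r :=
  lift_alg ω _ _ _ _ r

/-- constants -/
noncomputable def e0 : MvPolynomial (Fin 0) K →+* K :=
  (MvPolynomial.isEmptyAlgEquiv K (Fin 0)).toAlgHom.toRingHom

lemma e0_C (k : K) : e0 (MvPolynomial.C k) = k := (MvPolynomial.isEmptyAlgEquiv K (Fin 0)).commutes k

lemma e0_bij : Function.Bijective (e0 : MvPolynomial (Fin 0) K → K) :=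
  (MvPolynomial.isEmptyAlgEquiv K (Fin 0)).bijective

/-- base case map, as a ring homomorphism -/
noncomputable def base1 : PW (0 : Fin N → Fin N → MvPolynomial (Fin 0) K) →+* MvPolynomial (Fin N) K :=
  (MvPolynomial.map e0).comp (toPoly (MvPolynomial (Fin 0) K) N).toRingHom

lemma base1_apply (a : PW (0 : Fin N → Fin N → MvPolynomial (Fin 0) K)) : base1 a =
    MvPolynomial.map e0 (toPoly (MvPolynomial (Fin 0) K) N a) := rfl

lemma base1_comm (k : K) : base1 (algebraMap K (PW (0 : Fin N → Fin N → MvPolynomial (Fin 0) K)) k) =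
    algebraMap K (MvPolynomial (Fin N) K) k := by
  rw [kalg_map, base1_apply, AlgHom.commutes, MvPolynomial.algebraMap_eq, MvPolynomial.map_C, e0_C,
    MvPolynomial.algebraMap_eq]

/-- base case map -/
noncomputable def base0 : PW (0 : Fin N → Fin N → MvPolynomial (Fin 0) K) →ₐ[K] MvPolynomial (Fin N) K :=
  AlgHom.mk base1 base1_comm

lemma base0_apply (a : PW (0 : Fin N → Fin N → MvPolynomial (Fin 0) K)) : base0 a =
    MvPolynomial.map e0 (toPoly (MvPolynomial (Fin 0) K) N a) := rfl

lemma base0_bij : Function.Bijective (base0 : PW (0 : Fin N → Fin N → MvPolynomial (Fin 0) K) → MvPolynomial (Fin N) K) :=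
  Function.Bijective.comp (g := MvPolynomial.map e0)
    ⟨MvPolynomial.map_injective _ e0_bij.1, MvPolynomial.map_surjective _ e0_bij.2⟩ (toPoly_bij _ N)

/-- the reduction map as an algebra homomorphism -/
noncomputable def red {m : ℕ} (ω : Fin N → Fin N → MvPolynomial (Fin (m+1)) K)
    (ω' : Fin N → Fin N → MvPolynomial (Fin m) K)
    (h : ∀ i j, ω' i j = (MvPolynomial.aeval (R := K) (Fin.cons 0 MvPolynomial.X : Fin (m+1) → MvPolynomial (Fin m) K)).toRingHom (ω i j)) :
    PW ω →ₐ[K] PW ω' :=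
  { bc _ ω ω' h with
    commutes' k := by
      refine (bc_alg h (MvPolynomial.C k)).trans ?_
      rw [kalg_map]
      congr 1
      simp }

lemma divides_iff {R : Type} [CommRing R] (z : R) {N : ℕ} (p : MvPolynomial (Fin N) R)
    (h : ∀ s, ∃ q, MvPolynomial.coeff s p = z * q) : ∃ q, p = z • q := by
  have : MvPolynomial.C z ∣ p := (MvPolynomial.C_dvd_iff_dvd_coeff z p).2 h
  obtain ⟨q, hq⟩ := this
  exact ⟨q, by rw [hq, MvPolynomial.smul_eq_C_mul]⟩

theorem gor (m : ℕ) (ω : Fin N → Fin N → MvPolynomial (Fin m) K) (h0 : ∀ i, ω i i = 0)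
    (h1 : ∀ i j, ω i j = - ω j i)
    (hc : ∀ i j, MvPolynomial.aeval (0 : Fin m → K) (ω i j) = 0) :
    PSGor (PW ω) (aug ω hc) (N + m) := by
  induction m with
  | zero =>
    obtain rfl : ω = 0 := by
      funext i j
      have := hc i j
      rw [MvPolynomial.eq_C_of_isEmpty (ω i j)] at this ⊢
      simp at this
      simp [this]
    refine PSGor.of_equiv (PSGor.mvPoly N) (AlgEquiv.ofBijective base0 base0_bij) ?_
    intro a
    refine hom_ext (f := (aug _ hc).toRingHom) (g := (MvPolynomial.aeval (0 : Fin N → K)).toRingHom.comp base0.toRingHom) ?_ ?_ a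
    · intro r
      rw [MvPolynomial.eq_C_of_isEmpty r]
      refine ((aug _ hc).commutes _).trans ?_
      refine (((MvPolynomial.aeval (0 : Fin N → K)).comp base0).commutes _).symm
    · intro i
      refine (aug_x _ hc i).trans ?_
      show _ = MvPolynomial.aeval (0 : Fin N → K) (base0 (x _ i))
      rw [base0_apply]
      simp [toPoly, liftA_x]
  | succ m ih =>
    let ω' : Fin N → Fin N → MvPolynomial (Fin m) K := fun i j => 
      (MvPolynomial.aeval (R := K) (Fin.cons 0 MvPolynomial.X : Fin (m+1) → MvPolynomial (Fin m) K)).toRingHom (ω i j)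
    have h : ∀ i j, ω' i j = (MvPolynomial.aeval (R := K) (Fin.cons 0 MvPolynomial.X : Fin (m+1) → MvPolynomial (Fin m) K)).toRingHom (ω i j) := fun _ _ => rfl
    have hcc : (MvPolynomial.aeval (0 : Fin m → K)).comp (MvPolynomial.aeval (R := K) (Fin.cons 0 MvPolynomial.X : Fin (m+1) → MvPolynomial (Fin m) K))
      = MvPolynomial.aeval (0 : Fin (m+1) → K) := by
      ext i
      refine Fin.cases ?_ (fun j => ?_) i <;> simp
    have h0' : ∀ i, ω' i i = 0 := fun i => by rw [h, h0, map_zero]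
    have h1' : ∀ i j, ω' i j = - ω' j i := fun i j => by rw [h, h1, map_neg, h]
    have hc' : ∀ i j, MvPolynomial.aeval (0 : Fin m → K) (ω' i j) = 0 := fun i j =>
      (DFunLike.congr_fun hcc (ω i j)).trans (hc i j)
    have hbc := pbw_bc h h0 h1 h0' h1'
    have hred : ∀ a, red ω ω' h a = bc _ ω ω' h a := fun a => rfl
    refine PSGor.step (red ω ω' h) ?_ (algebraMap (MvPolynomial (Fin (m+1)) K) _ (MvPolynomial.X 0))
      (fun a => (Algebra.commutes _ _).symm) ?_ ?_ (ih ω' h0' h1' hc') ?_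
    · intro b
      obtain ⟨p, hp⟩ := MvPolynomial.map_surjective (σ := Fin N) _ (ps_kill_surj (S := K) m) (pbw h0' h1' b)
      obtain ⟨a, rfl⟩ := (pbw_bij h0 h1).2 p
      refine ⟨a, (pbw_bij h0' h1').1 ?_⟩
      rw [hred, hbc]
      exact hp
    · intro a ha
      rw [← Algebra.smul_def] at ha
      apply (pbw_bij h0 h1).1
      have := congrArg (pbw h0 h1) ha
      rw [map_smul, map_zero] at this
      rw [map_zero]
      refine (smul_eq_zero.1 this).resolve_left ?_
      exact MvPolynomial.X_ne_zero 0
    · intro a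
      constructor
      · intro ha
        have h2 := congrArg (pbw h0' h1') ha
        rw [hred, hbc, map_zero] at h2
        obtain ⟨q, hq⟩ := divides_iff (MvPolynomial.X 0) (pbw h0 h1 a) (by
          intro s
          apply (ps_kill m _).1
          have := congrArg (MvPolynomial.coeff s) h2
          rw [MvPolynomial.coeff_map] at this
          exact this)
        obtain ⟨b, rfl⟩ := (pbw_bij h0 h1).2 q
        refine ⟨b, (pbw_bij h0 h1).1 ?_⟩
        rw [← Algebra.smul_def, map_smul, hq]
      · rintro ⟨b, rfl⟩
        rw [map_mul, hred, bc_alg]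
        simp
    · intro a
      refine hom_ext (f := (aug ω hc).toRingHom) (g := (aug ω' hc').toRingHom.comp (red ω ω' h).toRingHom) ?_ ?_ a
      · intro r
        refine (aug_alg ω hc r).trans ?_
        show _ = aug ω' hc' (bc _ ω ω' h _)
        rw [bc_alg, aug_alg]
        exact (DFunLike.congr_fun hcc r).symm
      · intro i
        refine (aug_x ω hc i).trans ?_
        show _ = aug ω' hc' (bc _ ω ω' h _)
        rw [bc_x, aug_x]
end
end PW

section PSfinal
variable (K : Type) [Field K] (N : ℕ)

/-- generators of the parastatistics algebra -/
noncomputable def psGen (v : Fin N → K) : PS K (Fin N → K) :=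
  RingQuot.mkAlgHom K (psRel K (Fin N → K)) (TensorAlgebra.ι K v)

lemma psGen_add (v w : Fin N → K) : psGen K N (v + w) = psGen K N v + psGen K N w := by
  simp [psGen]
lemma psGen_smul (r : K) (v : Fin N → K) : psGen K N (r • v) = r • psGen K N v := by
  simp [psGen]

lemma psGen_rel (u v w : Fin N → K) :
    ⁅⁅psGen K N u, psGen K N v⁆, psGen K N w⁆ = 0 := by
  have := RingQuot.mkAlgHom_rel K (s := psRel K (Fin N → K)) ⟨u, v, w, rfl, rfl⟩
  simpa [Ring.lie_def, psGen] using this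

lemma ps_induction (P : PS K (Fin N → K) → Prop)
    (halg : ∀ r, P (algebraMap K _ r)) (hx : ∀ v, P (psGen K N v))
    (hadd : ∀ a b, P a → P b → P (a + b)) (hmul : ∀ a b, P a → P b → P (a * b)) (a) : P a := by
  obtain ⟨a, rfl⟩ := RingQuot.mkAlgHom_surjective K (psRel K (Fin N → K)) a
  refine TensorAlgebra.induction (C := fun a => P (RingQuot.mkAlgHom K (psRel K (Fin N → K)) a)) ?_ ?_ ?_ ?_ a
  · intro r
    rw [AlgHom.commutes]
    exact halg r
  · exact hx
  · intro a b ha hb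
    rw [map_mul]
    exact hmul _ _ ha hb
  · intro a b ha hb
    rw [map_add]
    exact hadd _ _ ha hb

lemma psGen_central (u v : Fin N → K) (a : PS K (Fin N → K)) :
    ⁅psGen K N u, psGen K N v⁆ * a = a * ⁅psGen K N u, psGen K N v⁆ := by
  refine ps_induction K N (fun a => ⁅psGen K N u, psGen K N v⁆ * a = a * ⁅psGen K N u, psGen K N v⁆) ?_ ?_ ?_ ?_ a
  · intro r
    exact (Algebra.commutes _ _).symm
  · intro w
    have := psGen_rel K N u v w
    rw [Ring.lie_def] at this
    exact sub_eq_zero.1 this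
  · intro a b ha hb
    rw [mul_add, add_mul, ha, hb]
  · intro a b ha hb
    rw [← mul_assoc, ha, mul_assoc, hb, mul_assoc]

/-- pairs -/
abbrev PSPair := {p : Fin N × Fin N // p.1 < p.2}

lemma psPair_card : N + Fintype.card (PSPair N) = N * (N + 1) / 2 := by
  have h1 : Fintype.card (PSPair N) = N.choose 2 := by
    let e : PSPair N ≃ (Σ j : Fin N, Fin (j : ℕ)) :=
      { toFun p := ⟨p.1.2, ⟨p.1.1, p.2⟩⟩
        invFun q := ⟨(⟨q.2, q.2.2.trans q.1.2⟩, q.1), q.2.2⟩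
        left_inv p := rfl
        right_inv q := rfl }
    rw [Fintype.card_congr e, Fintype.card_sigma]
    simp only [Fintype.card_fin]
    rw [Fin.sum_univ_eq_sum_range (fun i => i) N, Finset.sum_range_id, Nat.choose_two_right]
  rw [h1, Nat.choose_two_right]
  rcases N with _ | n
  · rfl
  · have h2 : (n + 1) * (n + 1 + 1) = (n + 1) * (n + 1 - 1) + (n + 1) * 2 := by
      simp; ring
    rw [h2, Nat.add_mul_div_right _ _ (by norm_num)]
    omega

variable {N} in
/-- the generic form with coefficients in any commutative or noncommutative ring -/
def psForm {S : Type} [Ring S] (c : PSPair N → S) (i j : Fin N) : S :=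
  if h : i < j then c ⟨(i, j), h⟩ else if h : j < i then - c ⟨(j, i), h⟩ else 0

/-- the generic form -/
noncomputable def psOm : Fin N → Fin N → MvPolynomial (Fin (Fintype.card (PSPair N))) K :=
  psForm fun p => MvPolynomial.X (Fintype.equivFin _ p)

lemma psOm_zero (i : Fin N) : psOm K N i i = 0 := by
  simp [psOm, psForm]
lemma psOm_neg (i j : Fin N) : psOm K N i j = - psOm K N j i := by
  rcases lt_trichotomy i j with h | h | h
  · simp [psOm, psForm, h, h.not_gt]
  · subst h
    simp [psOm, psForm]
  · simp [psOm, psForm, h, h.not_gt]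
lemma psOm_aug (i j : Fin N) : MvPolynomial.aeval (0 : Fin (Fintype.card (PSPair N)) → K) (psOm K N i j) = 0 := by
  unfold psOm psForm
  split_ifs <;> simp

/-- central coefficients -/
noncomputable def psSigma : MvPolynomial (Fin (Fintype.card (PSPair N))) K →ₐ[K] Subalgebra.center K (PS K (Fin N → K)) :=
  MvPolynomial.aeval fun k => 
    ⟨⁅psGen K N (Pi.single ((Fintype.equivFin (PSPair N)).symm k).1.1 1), 
      psGen K N (Pi.single ((Fintype.equivFin (PSPair N)).symm k).1.2 1)⁆, 
      Subalgebra.mem_center_iff.2 fun b => (psGen_central K N _ _ b).symm⟩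

lemma psSigma_om (i j : Fin N) : (psSigma K N (psOm K N i j) : PS K (Fin N → K)) = 
    ⁅psGen K N (Pi.single i 1), psGen K N (Pi.single j 1)⁆ := by
  unfold psOm psForm
  split_ifs with h1 h2
  · simp [psSigma]
  · simp [psSigma, Ring.lie_def]
  · obtain rfl : i = j := le_antisymm (not_lt.1 h2) (not_lt.1 h1)
    simp [Ring.lie_def]

/-- the map back -/
noncomputable def psBack : PW (psOm K N) →+* PS K (Fin N → K) :=
  PW.lift _ ((Subalgebra.center K (PS K (Fin N → K))).val.toRingHom.comp (psSigma K N).toRingHom)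
    (fun r s => (Subalgebra.mem_center_iff.1 (psSigma K N r).2 s).symm)
    (fun i => psGen K N (Pi.single i 1)) (by
      intro i j
      have := psSigma_om K N i j
      refine Eq.trans ?_ (congrArg (fun t => psGen K N (Pi.single j 1) * psGen K N (Pi.single i 1) + t) this.symm)
      simp [Ring.lie_def])

lemma psBack_x (i : Fin N) : psBack K N (PW.x _ i) = psGen K N (Pi.single i 1) := PW.lift_x _ _ _ _ _ _
lemma psBack_alg (r) : psBack K N (algebraMap (MvPolynomial (Fin (Fintype.card (PSPair N))) K) _ r) = psSigma K N r :=
  PW.lift_alg _ _ _ _ _ _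

lemma pw_lie (i j : Fin N) : ⁅PW.x (psOm K N) i, PW.x (psOm K N) j⁆ = algebraMap _ _ (psOm K N i j) := by
  rw [Ring.lie_def, PW.x_mul]
  simp

/-- generic linear element -/
noncomputable def pwLin : (Fin N → K) →ₗ[K] PW (psOm K N) := Fintype.linearCombination K (PW.x (psOm K N))

lemma pwLin_single (i : Fin N) : pwLin K N (Pi.single i 1) = PW.x _ i := by
  simp [pwLin]

lemma pwLin_lie (u v : Fin N → K) (a : PW (psOm K N)) : ⁅⁅pwLin K N u, pwLin K N v⁆, a⁆ = 0 := by
  have : ⁅pwLin K N u, pwLin K N v⁆ ∈ Subalgebra.center K (PW (psOm K N)) := by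
    have h1 : ⁅pwLin K N u, pwLin K N v⁆ = ∑ i, ∑ j, (u i * v j) • 
        algebraMap (MvPolynomial (Fin (Fintype.card (PSPair N))) K) (PW (psOm K N)) (psOm K N i j) := by
      simp only [pwLin, Fintype.linearCombination_apply, ← pw_lie]
      rw [Ring.lie_def, Finset.sum_mul_sum, Finset.sum_mul_sum, Finset.sum_comm (γ := Fin N) (f := fun i j => (v i • PW.x (psOm K N) i) * (u j • PW.x (psOm K N) j)),
        ← Finset.sum_sub_distrib]
      refine Finset.sum_congr rfl fun i _ => ?_
      rw [← Finset.sum_sub_distrib]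
      refine Finset.sum_congr rfl fun j _ => ?_
      rw [Ring.lie_def, smul_mul_smul_comm, smul_mul_smul_comm, smul_sub, mul_comm (v j)]
    rw [h1]
    refine Subalgebra.sum_mem _ fun i _ => Subalgebra.sum_mem _ fun j _ => 
      Subalgebra.smul_mem _ ?_ _
    exact Subalgebra.mem_center_iff.2 fun b => (Algebra.commutes _ b).symm
  rw [Ring.lie_def, Subalgebra.mem_center_iff.1 this a, sub_self]

/-- the map forward -/
noncomputable def psFwd : PS K (Fin N → K) →ₐ[K] PW (psOm K N) :=
  RingQuot.liftAlgHom K (s := psRel K (Fin N → K))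
    ⟨TensorAlgebra.lift K (pwLin K N), by
      rintro a b ⟨x, y, z, rfl, rfl⟩
      have := pwLin_lie K N x y (pwLin K N z)
      simpa [Ring.lie_def] using this⟩

lemma psFwd_gen (v : Fin N → K) : psFwd K N (psGen K N v) = pwLin K N v := by
  simp [psFwd, psGen]

lemma psBack_fwd (a) : psBack K N (psFwd K N a) = a := by
  refine ps_induction K N (fun a => psBack K N (psFwd K N a) = a) ?_ ?_ ?_ ?_ a
  · intro r
    rw [AlgHom.commutes, PW.kalg_map, psBack_alg]
    simp [psSigma]
  · intro v
    rw [psFwd_gen]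
    simp only [pwLin, Fintype.linearCombination_apply, map_sum]
    have : ∀ i, psBack K N (v i • PW.x (psOm K N) i) = psGen K N (Pi.single i (v i)) := by
      intro i
      rw [Algebra.smul_def, map_mul, psBack_x, PW.kalg_map, psBack_alg]
      have h2 : (Pi.single i (v i) : Fin N → K) = v i • Pi.single i 1 := by
        rw [← Pi.single_smul]; simp
      rw [h2, psGen_smul, Algebra.smul_def]
      simp [psSigma]
    simp only [this]
    let g : (Fin N → K) →+ PS K (Fin N → K) := AddMonoidHom.mk' (psGen K N) (psGen_add K N)
    have h3 := map_sum g (fun i => (Pi.single i (v i) : Fin N → K)) Finset.univ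
    rw [Finset.univ_sum_single] at h3
    exact h3.symm
  · intro a b ha hb
    rw [map_add, map_add, ha, hb]
  · intro a b ha hb
    rw [map_mul, map_mul, ha, hb]

lemma psFwd_surj : Function.Surjective (psFwd K N) := by
  intro a
  suffices a ∈ (psFwd K N).range from this
  refine PW.gen_induction _ (fun a => a ∈ (psFwd K N).range) ?_ ?_ (fun a b => add_mem) (fun a b => mul_mem) a
  · intro r
    induction r using MvPolynomial.induction_on with
    | C k => 
      rw [← PW.kalg_map]
      exact Subalgebra.algebraMap_mem _ k
    | add p q hp hq => 
      rw [map_add]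
      exact add_mem hp hq
    | mul_X p k hp =>
      rw [map_mul]
      refine mul_mem hp ?_
      obtain ⟨⟨⟨i, j⟩, hij⟩, rfl⟩ := (Fintype.equivFin (PSPair N)).surjective k
      refine ⟨⁅psGen K N (Pi.single i 1), psGen K N (Pi.single j 1)⁆, ?_⟩
      have h2 := pw_lie K N i j
      simp only at hij
      rw [psOm, psForm, dif_pos hij] at h2
      refine Eq.trans ?_ h2
      simp [Ring.lie_def, psFwd_gen, pwLin_single]
      rfl
  · intro i
    exact ⟨psGen K N (Pi.single i 1), by
      refine (psFwd_gen K N _).trans ?_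
      rw [pwLin_single]⟩

/-- the isomorphism -/
noncomputable def psEquiv : PS K (Fin N → K) ≃ₐ[K] PW (psOm K N) :=
  AlgEquiv.ofBijective (psFwd K N) ⟨Function.LeftInverse.injective (psBack_fwd K N), psFwd_surj K N⟩

lemma psAug_gen (v : Fin N → K) : psAug K (Fin N → K) (psGen K N v) = 0 := by
  simp [psAug, psGen]

theorem ps_gor : PSGor (PS K (Fin N → K)) (psAug K (Fin N → K)) (N * (N + 1) / 2) := by
  rw [← psPair_card]
  refine PSGor.of_equiv (PW.gor _ (psOm K N) (psOm_zero K N) (psOm_neg K N) (psOm_aug K N)) (psEquiv K N) ?_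
  intro a
  show psAug K (Fin N → K) a = PW.aug (psOm K N) (psOm_aug K N) (psFwd K N a)
  refine ps_induction K N (fun a => psAug K (Fin N → K) a = PW.aug (psOm K N) (psOm_aug K N) (psFwd K N a)) ?_ ?_ ?_ ?_ a
  · intro r
    rw [AlgHom.commutes, AlgHom.commutes, AlgHom.commutes]
  · intro v
    rw [psAug_gen, psFwd_gen]
    simp [pwLin, Fintype.linearCombination_apply, PW.aug_x]
  · intro a b ha hb
    rw [map_add, map_add, map_add, ha, hb]
  · intro a b ha hb
    rw [map_mul, map_mul, map_mul, ha, hb]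

end PSfinal

open CategoryTheory in
/-- **Gorenstein property of the parastatistics algebra**: with `A = T(K^N)/⟨[[x,y],z]⟩`,
`K` the `A`-module given by the augmentation, and `d = N(N+1)/2`, the groups
`Ext^i_A(K, A)` vanish for `i ≠ d`, and `Ext^d_A(K, A)` is a one-dimensional
`K`-vector space. -/
theorem parastatistics_gorenstein (K : Type) [Field K] [CharZero K] (N : ℕ) (hN : 0 < N) :
    (∀ i : ℕ, i ≠ N * (N + 1) / 2 →
      Subsingleton
        (((Ext K (ModuleCat (PS K (Fin N → K))) i).obj
            (Opposite.op (ModuleCat.of (PS K (Fin N → K)) K))).obj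
          (ModuleCat.of (PS K (Fin N → K)) (PS K (Fin N → K))))) ∧
    Module.finrank K
      (((Ext K (ModuleCat (PS K (Fin N → K))) (N * (N + 1) / 2)).obj
          (Opposite.op (ModuleCat.of (PS K (Fin N → K)) K))).obj
        (ModuleCat.of (PS K (Fin N → K)) (PS K (Fin N → K)))) = 1 := by
  have h := ps_gor K N (PS K (Fin N → K)) AlgEquiv.refl
  have hM : (psR ((psAug K (Fin N → K)).comp (AlgEquiv.refl : PS K (Fin N → K) ≃ₐ[K] PS K (Fin N → K)).toAlgHom)).obj (ModuleCat.of K K) =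
    ModuleCat.of (PS K (Fin N → K)) K := rfl
  unfold PSP at h
  rw [hM] at h
  refine ⟨?_, ?_⟩
  · intro i hi
    obtain ⟨e⟩ := ps_ext_compare (K := K) (ModuleCat.of (PS K (Fin N → K)) K)
      (ModuleCat.of (PS K (Fin N → K)) (PS K (Fin N → K))) i
    have := h.1 i hi
    exact e.toEquiv.subsingleton
  · obtain ⟨e⟩ := ps_ext_compare (K := K) (ModuleCat.of (PS K (Fin N → K)) K)
      (ModuleCat.of (PS K (Fin N → K)) (PS K (Fin N → K))) (N * (N + 1) / 2)
    rw [e.finrank_eq]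
    exact h.2
end

section
/- Poincaré duality of Betti numbers, combinatorial form: for every positive integer N, set d = N(N+1)/2; then for every n with 0 ≤ n ≤ d, Σ_{λ self-conjugate, (|λ|+r(λ))/2 = n} #SSYT_N(λ) = Σ_{λ self-conjugate, (|λ|+r(λ))/2 = d−n} #SSYT_N(λ), where #SSYT_N(λ) denotes the number of semistandard Young tableaux of shape λ with entries in {0,…,N−1}. -/
/-- The rank of a Young diagram: the number of diagonal cells. -/
def YoungDiagram.diagRank (lam : YoungDiagram) : ℕ :=
  (lam.cells.filter fun c => c.1 = c.2).card

/-- The number of semistandard Young tableaux of shape `lam` with entries in `{0, …, N-1}`. -/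
noncomputable def ssytCount (N : ℕ) (lam : YoungDiagram) : ℕ :=
  Nat.card {T : SemistandardYoungTableau lam // ∀ i j : ℕ, (i, j) ∈ lam → T i j < N}

open Classical in
/-- Complement of a diagram in the `N × N` box, rotated. -/
noncomputable def boxCompl (N : ℕ) (lam : YoungDiagram) : YoungDiagram where
  cells := (Finset.range N ×ˢ Finset.range N).filter
    fun c => (N - 1 - c.1, N - 1 - c.2) ∉ lam
  isLowerSet := by
    rintro ⟨a, b⟩ ⟨c, d⟩ ⟨h1, h2⟩ h
    simp only [Finset.coe_filter, Finset.mem_product, Finset.mem_range, Set.mem_ofPred_eq] at h ⊢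
    simp only at h1 h2
    refine ⟨⟨by omega, by omega⟩, fun h' => h.2 (lam.up_left_mem ?_ ?_ h')⟩ <;> omega

theorem mem_boxCompl {N : ℕ} {lam : YoungDiagram} {i j : ℕ} :
    (i, j) ∈ boxCompl N lam ↔ (i < N ∧ j < N) ∧ (N - 1 - i, N - 1 - j) ∉ lam := by
  rw [← YoungDiagram.mem_cells]
  unfold boxCompl
  simp only [Finset.mem_filter, Finset.mem_product, Finset.mem_range]

def InBox (N : ℕ) (lam : YoungDiagram) : Prop := ∀ i j, (i, j) ∈ lam → i < N ∧ j < N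

theorem inBox_boxCompl (N : ℕ) (lam : YoungDiagram) : InBox N (boxCompl N lam) :=
  fun _ _ h => (mem_boxCompl.1 h).1

theorem boxCompl_boxCompl {N : ℕ} {lam : YoungDiagram} (h : InBox N lam) :
    boxCompl N (boxCompl N lam) = lam := by
  ext ⟨i, j⟩
  simp only [YoungDiagram.mem_cells, mem_boxCompl]
  constructor
  · rintro ⟨⟨h1, h2⟩, h3⟩
    by_contra h4
    apply h3
    refine ⟨by omega, ?_⟩
    rwa [show N - 1 - (N - 1 - i) = i by omega, show N - 1 - (N - 1 - j) = j by omega]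
  · intro h'
    obtain ⟨h1, h2⟩ := h _ _ h'
    refine ⟨⟨h1, h2⟩, fun h3 => h3.2 ?_⟩
    rwa [show N - 1 - (N - 1 - i) = i by omega, show N - 1 - (N - 1 - j) = j by omega]

theorem boxCompl_transpose {N : ℕ} {lam : YoungDiagram} (h : lam.transpose = lam) :
    (boxCompl N lam).transpose = boxCompl N lam := by
  have hs : ∀ a b, (a, b) ∈ lam ↔ (b, a) ∈ lam := fun a b => by
    conv_lhs => rw [← h]
    simp
  ext ⟨i, j⟩
  simp only [YoungDiagram.mem_cells, YoungDiagram.mem_transpose, Prod.swap_prod_mk, mem_boxCompl]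
  rw [hs (N - 1 - j), and_comm (a := j < N)]

open Classical in
theorem card_boxCompl {N : ℕ} {lam : YoungDiagram} (h : InBox N lam) :
    (boxCompl N lam).card + lam.card = N * N := by
  have h1 : lam.card = ((Finset.range N ×ˢ Finset.range N).filter
      fun c => (N - 1 - c.1, N - 1 - c.2) ∈ lam).card := by
    refine Finset.card_nbij' (fun c => (N - 1 - c.1, N - 1 - c.2))
      (fun c => (N - 1 - c.1, N - 1 - c.2)) ?_ ?_ ?_ ?_
    · rintro ⟨i, j⟩ hc
      have hc' : (i, j) ∈ lam := by simpa using hc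
      obtain ⟨h1, h2⟩ := h _ _ hc'
      simp only [Finset.coe_filter, Finset.mem_product, Finset.mem_range, Set.mem_ofPred_eq]
      refine ⟨by omega, ?_⟩
      rwa [show N - 1 - (N - 1 - i) = i by omega, show N - 1 - (N - 1 - j) = j by omega]
    · rintro ⟨i, j⟩ hc
      simp only [Finset.coe_filter, Finset.mem_product, Finset.mem_range, Set.mem_ofPred_eq] at hc
      simpa using hc.2
    · rintro ⟨i, j⟩ hc
      have hc' : (i, j) ∈ lam := by simpa using hc
      obtain ⟨h1, h2⟩ := h _ _ hc'
      simp only [Prod.mk.injEq]; omega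
    · rintro ⟨i, j⟩ hc
      simp only [Finset.coe_filter, Finset.mem_product, Finset.mem_range, Set.mem_ofPred_eq] at hc
      simp only [Prod.mk.injEq]; omega
  rw [h1, add_comm]
  have := Finset.card_filter_add_card_filter_not (s := Finset.range N ×ˢ Finset.range N)
    (fun c : ℕ × ℕ => (N - 1 - c.1, N - 1 - c.2) ∈ lam)
  simpa [boxCompl] using this

open Classical in
theorem diagRank_eq {N : ℕ} {lam : YoungDiagram} (h : InBox N lam) :
    lam.diagRank = ((Finset.range N).filter fun i => (i, i) ∈ lam).card := by
  refine Finset.card_nbij' (fun c => c.1) (fun i => (i, i)) ?_ ?_ ?_ ?_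
  · rintro ⟨i, j⟩ hc
    simp only [Finset.coe_filter, YoungDiagram.mem_cells, Set.mem_ofPred_eq] at hc
    obtain ⟨hc, rfl⟩ := hc
    simpa using ⟨(h _ _ hc).1, hc⟩
  · intro i hc
    simp only [Finset.coe_filter, Finset.mem_range, Set.mem_ofPred_eq] at hc
    simpa using hc.2
  · rintro ⟨i, j⟩ hc
    simp only [Finset.coe_filter, YoungDiagram.mem_cells, Set.mem_ofPred_eq] at hc
    simpa using hc.2
  · intro i hc
    rfl

open Classical in
theorem diagRank_boxCompl {N : ℕ} {lam : YoungDiagram} (h : InBox N lam) :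
    (boxCompl N lam).diagRank + lam.diagRank = N := by
  rw [diagRank_eq h, diagRank_eq (inBox_boxCompl N lam)]
  have := Finset.card_filter_add_card_filter_not (s := Finset.range N)
    (fun i : ℕ => (i, i) ∈ lam)
  rw [Finset.card_range] at this
  refine Eq.trans ?_ this
  rw [add_comm]
  congr 1
  refine Finset.card_nbij' (fun i => N - 1 - i) (fun i => N - 1 - i) ?_ ?_ ?_ ?_
  · intro i hc
    simp only [Finset.coe_filter, Finset.mem_range, Set.mem_ofPred_eq, mem_boxCompl] at hc ⊢
    exact ⟨by omega, hc.2.2⟩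
  · intro i hc
    simp only [Finset.coe_filter, Finset.mem_range, Set.mem_ofPred_eq, mem_boxCompl] at hc ⊢
    refine ⟨by omega, by omega, ?_⟩
    rw [show N - 1 - (N - 1 - i) = i by omega]
    exact hc.2
  · intro i hc
    simp only [Finset.coe_filter, Finset.mem_range, Set.mem_ofPred_eq] at hc
    simp only; omega
  · intro i hc
    simp only [Finset.coe_filter, Finset.mem_range, Set.mem_ofPred_eq] at hc
    simp only; omega

/-- `v` occurs in column `j`. -/
def ColP {lam : YoungDiagram} (T : SemistandardYoungTableau lam) (j v : ℕ) : Prop :=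
  ∃ i, (i, j) ∈ lam ∧ T i j = v

/-- `v` does not occur in the reversed column. -/
def ColQ (N : ℕ) {lam : YoungDiagram} (T : SemistandardYoungTableau lam) (j v : ℕ) : Prop :=
  v < N ∧ ¬ ColP T (N - 1 - j) v

theorem col_inj {lam : YoungDiagram} (T : SemistandardYoungTableau lam) {i i' j : ℕ}
    (h : (i, j) ∈ lam) (h' : (i', j) ∈ lam) : T i' j < T i j ↔ i' < i := by
  constructor
  · intro hlt
    by_contra hc
    exact absurd (T.col_weak (not_lt.1 hc) h') (by omega)
  · intro hlt
    exact T.col_strict hlt h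

open Classical in
theorem count_colP {lam : YoungDiagram} (T : SemistandardYoungTableau lam) (j k : ℕ) :
    Nat.count (ColP T j) k = ((Finset.range (lam.colLen j)).filter fun i => T i j < k).card := by
  rw [Nat.count_eq_card_filter_range]
  symm
  refine Finset.card_nbij (fun i => T i j) ?_ ?_ ?_
  · intro i hi
    simp only [Finset.coe_filter, Finset.mem_range, Set.mem_ofPred_eq] at hi ⊢
    exact ⟨hi.2, i, YoungDiagram.mem_iff_lt_colLen.2 hi.1, rfl⟩
  · intro i hi i' hi' he
    simp only [Finset.coe_filter, Finset.mem_range, Set.mem_ofPred_eq] at hi hi' he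
    have h1 := YoungDiagram.mem_iff_lt_colLen.2 hi.1
    have h2 := YoungDiagram.mem_iff_lt_colLen.2 hi'.1
    have := col_inj T h1 h2
    have := col_inj T h2 h1
    omega
  · intro v hv
    simp only [Finset.coe_filter, Finset.mem_range, Set.mem_ofPred_eq] at hv
    obtain ⟨hv, i, hi, rfl⟩ := hv
    refine ⟨i, ?_, rfl⟩
    simp only [Finset.coe_filter, Finset.mem_range, Set.mem_ofPred_eq]
    exact ⟨YoungDiagram.mem_iff_lt_colLen.1 hi, hv⟩

open Classical in
theorem count_colP_anti {lam : YoungDiagram} (T : SemistandardYoungTableau lam) {a b : ℕ}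
    (hab : a ≤ b) (k : ℕ) : Nat.count (ColP T b) k ≤ Nat.count (ColP T a) k := by
  rw [count_colP, count_colP]
  apply Finset.card_le_card
  intro i hi
  simp only [Finset.mem_filter, Finset.mem_range] at hi ⊢
  have h1 := YoungDiagram.mem_iff_lt_colLen.2 hi.1
  refine ⟨lt_of_lt_of_le hi.1 (lam.colLen_anti _ _ hab), ?_⟩
  exact lt_of_le_of_lt (T.row_weak_of_le hab h1) hi.2

open Classical in
theorem count_colP_entry {lam : YoungDiagram} (T : SemistandardYoungTableau lam) {i j : ℕ}
    (h : (i, j) ∈ lam) : Nat.count (ColP T j) (T i j) = i := by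
  rw [count_colP]
  have : ((Finset.range (lam.colLen j)).filter fun i' => T i' j < T i j) = Finset.range i := by
    ext i'
    simp only [Finset.mem_filter, Finset.mem_range, ← YoungDiagram.mem_iff_lt_colLen]
    constructor
    · rintro ⟨h1, h2⟩
      exact (col_inj T h h1).1 h2
    · intro h1
      have h2 := lam.up_left_mem h1.le le_rfl h
      exact ⟨h2, (col_inj T h h2).2 h1⟩
  rw [this, Finset.card_range]

open Classical in
theorem count_colQ {N : ℕ} {lam : YoungDiagram} (T : SemistandardYoungTableau lam) (j : ℕ) {k : ℕ}
    (hk : k ≤ N) : Nat.count (ColQ N T j) k + Nat.count (ColP T (N - 1 - j)) k = k := by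
  rw [Nat.count_eq_card_filter_range, Nat.count_eq_card_filter_range]
  have := Finset.card_filter_add_card_filter_not (s := Finset.range k)
    (ColP T (N - 1 - j))
  rw [Finset.card_range] at this
  conv_rhs => rw [← this, add_comm]
  congr 2
  apply Finset.filter_congr
  intro v hv
  have := Finset.mem_range.1 hv
  exact ⟨fun h => h.2, fun h => ⟨by omega, h⟩⟩

open Classical in
theorem mem_boxCompl_iff {N : ℕ} {lam : YoungDiagram} (hb : InBox N lam)
    (T : SemistandardYoungTableau lam)
    (hT : ∀ i j : ℕ, (i, j) ∈ lam → T i j < N) {i j : ℕ} :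
    (i, j) ∈ boxCompl N lam ↔ j < N ∧ i < Nat.count (ColQ N T j) N := by
  have h1 := count_colQ (N := N) T j le_rfl
  have h2 : Nat.count (ColP T (N - 1 - j)) N = lam.colLen (N - 1 - j) := by
    rw [count_colP, Finset.filter_true_of_mem, Finset.card_range]
    intro i hi
    exact hT _ _ (YoungDiagram.mem_iff_lt_colLen.2 (Finset.mem_range.1 hi))
  rw [mem_boxCompl, YoungDiagram.mem_iff_lt_colLen]
  omega

theorem colQ_finite {N : ℕ} {lam : YoungDiagram} (T : SemistandardYoungTableau lam) (j : ℕ) :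
    (Set.ofPred (ColQ N T j)).Finite :=
  (Set.finite_Iio N).subset fun _ h => h.1

open Classical in
theorem colQ_nth {N : ℕ} {lam : YoungDiagram} (T : SemistandardYoungTableau lam) {i j : ℕ}
    (h : i < Nat.count (ColQ N T j) N) :
    ColQ N T j (Nat.nth (ColQ N T j) i) ∧
      Nat.count (ColQ N T j) (Nat.nth (ColQ N T j) i) = i := by
  have hi : ∀ hf : (Set.ofPred (ColQ N T j)).Finite, i < hf.toFinset.card := by
    intro hf
    refine lt_of_lt_of_le h ?_
    rw [Nat.count_eq_card_filter_range]
    apply Finset.card_le_card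
    intro v hv
    exact hf.mem_toFinset.2 (Finset.mem_filter.1 hv).2
  exact ⟨Nat.nth_mem i hi, Nat.count_nth hi⟩

open Classical in
/-- The complementary tableau. -/
noncomputable def complT {N : ℕ} {lam : YoungDiagram} (hb : InBox N lam)
    (T : SemistandardYoungTableau lam)
    (hT : ∀ i j : ℕ, (i, j) ∈ lam → T i j < N) : SemistandardYoungTableau (boxCompl N lam) where
  entry i j := if (i, j) ∈ boxCompl N lam then Nat.nth (ColQ N T j) i else 0
  row_weak' := by
    intro i j1 j2 hj h
    rw [if_pos h, if_pos ((boxCompl N lam).up_left_mem le_rfl hj.le h)]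
    rw [mem_boxCompl_iff hb T hT] at h
    obtain ⟨hx, hc⟩ := colQ_nth T h.2
    set x := Nat.nth (ColQ N T j2) i
    have h1 : Nat.count (ColQ N T j2) (x + 1) = i + 1 := by
      rw [Nat.count_succ, if_pos hx, hc]
    have hxN : x + 1 ≤ N := hx.1
    have h2 := count_colQ T j1 hxN
    have h3 := count_colQ T j2 hxN
    have h4 := count_colP_anti T (show N - 1 - j2 ≤ N - 1 - j1 by omega) (x + 1)
    have h5 : Nat.nth (ColQ N T j1) i < x + 1 := Nat.nth_lt_of_lt_count (by omega)
    omega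
  col_strict' := by
    intro i1 i2 j hi h
    have h' := (boxCompl N lam).up_left_mem hi.le le_rfl h
    rw [if_pos h, if_pos h']
    rw [mem_boxCompl_iff hb T hT] at h
    apply Nat.nth_lt_of_lt_count
    rw [(colQ_nth T h.2).2]
    exact hi
  zeros' := fun h => if_neg h

theorem complT_apply {N : ℕ} {lam : YoungDiagram} (hb : InBox N lam)
    (T : SemistandardYoungTableau lam)
    (hT : ∀ i j : ℕ, (i, j) ∈ lam → T i j < N) {i j : ℕ} (h : (i, j) ∈ boxCompl N lam) :
    complT hb T hT i j = Nat.nth (ColQ N T j) i := if_pos h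

open Classical in
theorem colP_complT {N : ℕ} {lam : YoungDiagram} (hb : InBox N lam)
    (T : SemistandardYoungTableau lam)
    (hT : ∀ i j : ℕ, (i, j) ∈ lam → T i j < N) {j v : ℕ} (hj : j < N) :
    ColP (complT hb T hT) j v ↔ ColQ N T j v := by
  constructor
  · rintro ⟨i, hi, rfl⟩
    rw [complT_apply hb T hT hi]
    exact (colQ_nth T ((mem_boxCompl_iff hb T hT).1 hi).2).1
  · intro hv
    have hi : (Nat.count (ColQ N T j) v, j) ∈ boxCompl N lam := by
      rw [mem_boxCompl_iff hb T hT]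
      exact ⟨hj, Nat.count_strict_mono hv hv.1⟩
    refine ⟨_, hi, ?_⟩
    rw [complT_apply hb T hT hi, Nat.nth_count hv]

theorem ssyt_finite (N : ℕ) {lam : YoungDiagram} :
    Finite {T : SemistandardYoungTableau lam // ∀ i j : ℕ, (i, j) ∈ lam → T i j < N} := by
  apply Finite.of_injective
    (β := lam.cells → Fin N)
    (fun T c => ⟨T.1 c.1.1 c.1.2, T.2 _ _ c.2⟩)
  intro T1 T2 h
  apply Subtype.ext
  ext i j
  by_cases hc : (i, j) ∈ lam
  · have := congrFun h ⟨(i, j), hc⟩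
    simpa using this
  · rw [T1.1.zeros hc, T2.1.zeros hc]

open Classical in
theorem ssytCount_le {N : ℕ} {lam : YoungDiagram} (hb : InBox N lam) :
    ssytCount N lam ≤ ssytCount N (boxCompl N lam) := by
  have := ssyt_finite N (lam := boxCompl N lam)
  refine Nat.card_le_card_of_injective (fun T => ⟨complT hb T.1 T.2, ?_⟩) ?_
  · intro i j h
    rw [complT_apply hb T.1 T.2 h]
    exact (colQ_nth T.1 ((mem_boxCompl_iff hb T.1 T.2).1 h).2).1.1
  · intro T1 T2 h
    have h' : complT hb T1.1 T1.2 = complT hb T2.1 T2.2 := congrArg Subtype.val h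
    have hQ : ∀ j < N, ∀ v, ColQ N T1.1 j v ↔ ColQ N T2.1 j v := by
      intro j hj v
      rw [← colP_complT hb T1.1 T1.2 hj, h', colP_complT hb T2.1 T2.2 hj]
    have hP : ∀ j < N, ColP T1.1 j = ColP T2.1 j := by
      intro j hj
      funext v
      apply propext
      have := hQ (N - 1 - j) (by omega) v
      unfold ColQ at this
      rw [show N - 1 - (N - 1 - j) = j by omega] at this
      by_cases hv : v < N
      · tauto
      · constructor
        · rintro ⟨i, hi, rfl⟩
          exact absurd (T1.2 _ _ hi) hv
        · rintro ⟨i, hi, rfl⟩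
          exact absurd (T2.2 _ _ hi) hv
    apply Subtype.ext
    ext i j
    by_cases hc : (i, j) ∈ lam
    · have h1 : ColP T1.1 j (T1.1 i j) := ⟨i, hc, rfl⟩
      have hp := hP j (hb _ _ hc).2
      have h3 := count_colP_entry T1.1 hc
      rw [hp] at h1
      obtain ⟨i2, hi2, he⟩ := h1
      have h4 := count_colP_entry T2.1 hi2
      simp only [he, hp] at h3 h4
      have : i2 = i := h4.symm.trans h3
      rw [← he, this]
    · rw [T1.1.zeros hc, T2.1.zeros hc]

theorem ssytCount_boxCompl {N : ℕ} {lam : YoungDiagram} (hb : InBox N lam) :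
    ssytCount N (boxCompl N lam) = ssytCount N lam := by
  refine le_antisymm ?_ (ssytCount_le hb)
  have := ssytCount_le (inBox_boxCompl N lam)
  rwa [boxCompl_boxCompl hb] at this

theorem inBox_of_ssytCount {N : ℕ} {lam : YoungDiagram} (ht : lam.transpose = lam)
    (h : ssytCount N lam ≠ 0) : InBox N lam := by
  have hN : (N, 0) ∉ lam := by
    intro hm
    apply h
    unfold ssytCount
    rw [Nat.card_eq_zero]
    left
    constructor
    rintro ⟨T, hT⟩
    have : ∀ k, k ≤ N → k ≤ T k 0 := by
      intro k
      induction k with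
      | zero => intro _; exact Nat.zero_le _
      | succ k ih =>
        intro hk
        have := ih (by omega)
        have := T.col_strict (Nat.lt_succ_self k) (lam.up_left_mem hk le_rfl hm)
        simp only [Nat.succ_eq_add_one] at this
        omega
    have h1 := this N le_rfl
    have h2 := hT _ _ hm
    omega
  have key : ∀ i j, (i, j) ∈ lam → i < N := by
    intro i j hm
    by_contra hc
    exact hN (lam.up_left_mem (not_lt.1 hc) (Nat.zero_le _) hm)
  intro i j hm
  refine ⟨key _ _ hm, key j i ?_⟩
  rw [← ht]
  simpa using hm

theorem boxCompl_mapsTo {N n m : ℕ} (hnm : n + m = N * (N + 1) / 2) {lam : YoungDiagram}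
    (hb : InBox N lam) (h : lam.transpose = lam ∧ lam.card + lam.diagRank = 2 * n) :
    (boxCompl N lam).transpose = boxCompl N lam ∧
      (boxCompl N lam).card + (boxCompl N lam).diagRank = 2 * m := by
  refine ⟨boxCompl_transpose h.1, ?_⟩
  have h1 := card_boxCompl hb
  have h2 := diagRank_boxCompl hb
  have h3 : N * (N + 1) / 2 * 2 = N * (N + 1) :=
    Nat.div_mul_cancel (Nat.even_mul_succ_self N).two_dvd
  have h4 : N * (N + 1) = N * N + N := by ring
  have h5 := h.2
  omega

/-- **Poincaré duality of Betti numbers, combinatorial form**: with `d = N(N+1)/2`,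
for `0 ≤ n ≤ d` the total number of SSYT with entries in `{0,…,N-1}` whose shapes are
self-conjugate diagrams `λ` with `(|λ| + r(λ))/2 = n` equals the corresponding count
with `n` replaced by `d - n`. -/
theorem betti_poincare_duality (N : ℕ) (hN : 0 < N) (n : ℕ) (hn : n ≤ N * (N + 1) / 2) :
    (∑ᶠ lam ∈ {lam : YoungDiagram |
        lam.transpose = lam ∧ lam.card + lam.diagRank = 2 * n}, ssytCount N lam) =
    (∑ᶠ lam ∈ {lam : YoungDiagram |
        lam.transpose = lam ∧ lam.card + lam.diagRank = 2 * (N * (N + 1) / 2 - n)},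
      ssytCount N lam) := by
  rw [← finsum_mem_inter_support, ← finsum_mem_inter_support (s := {lam : YoungDiagram |
        lam.transpose = lam ∧ lam.card + lam.diagRank = 2 * (N * (N + 1) / 2 - n)})]
  refine finsum_mem_eq_of_bijOn (boxCompl N) ?_ ?_
  · refine Set.InvOn.bijOn (f' := boxCompl N) ⟨?_, ?_⟩ ?_ ?_
    · rintro lam ⟨h, hs⟩
      exact boxCompl_boxCompl (inBox_of_ssytCount h.1 hs)
    · rintro lam ⟨h, hs⟩
      exact boxCompl_boxCompl (inBox_of_ssytCount h.1 hs)
    · rintro lam ⟨h, hs⟩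
      have hb := inBox_of_ssytCount h.1 hs
      refine ⟨boxCompl_mapsTo (by omega) hb h, ?_⟩
      rw [Function.mem_support, ssytCount_boxCompl hb]
      exact hs
    · rintro lam ⟨h, hs⟩
      have hb := inBox_of_ssytCount h.1 hs
      refine ⟨boxCompl_mapsTo (by omega) hb h, ?_⟩
      rw [Function.mem_support, ssytCount_boxCompl hb]
      exact hs
  · rintro lam ⟨h, hs⟩
    exact (ssytCount_boxCompl (inBox_of_ssytCount h.1 hs)).symm
end
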